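/- arXiv:1909.01833 — 2 statements merged into one kernel-verified Lean document; each statement's English description precedes it below -/
import Mathlib

section
/- Let k ≥ 3 be an integer. For any positive integer m, there are only finitely many isometry classes of strongly s-regular positive definite integral quadratic forms L of rank k with m_s(L) = m; that is, there exists a finite list of such forms so that every strongly s-regular form of rank k with m_s(L) = m is equivalent over GL_k(ℤ) to one of them. -/
open Finset

/-- The value of the integral quadratic form `∑_{i ≤ j} a i j * x i * x j` at `x`. -/
def qfVal {k : ℕ} (a : Fin k → Fin k → ℤ) (x : Fin k → ℤ) : ℤ :=
  ∑ i : Fin k, ∑ j : Fin k, if i ≤ j then a i j * x i * x j else 0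

/-- Positive definiteness of an integral quadratic form. -/
def qfPosDef {k : ℕ} (a : Fin k → Fin k → ℤ) : Prop :=
  ∀ x : Fin k → ℤ, x ≠ 0 → 0 < qfVal a x

/-- `qfRep a n` is the number of representations of `n` by the quadratic form. -/
noncomputable def qfRep {k : ℕ} (a : Fin k → Fin k → ℤ) (n : ℤ) : ℕ :=
  Set.ncard {x : Fin k → ℤ | qfVal a x = n}

/-- The Hessian matrix `(∂²f/∂xᵢ∂xⱼ)` of the quadratic form. -/
def qfHess {k : ℕ} (a : Fin k → Fin k → ℤ) : Matrix (Fin k) (Fin k) ℤ :=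
  Matrix.of fun i j => if i = j then 2 * a i i else if i < j then a i j else a j i

/-- The discriminant: determinant of the Hessian matrix. -/
def qfDisc {k : ℕ} (a : Fin k → Fin k → ℤ) : ℤ := (qfHess a).det

/-- The local factor `h_p(d, μ)` for a quadratic form of rank `k` with discriminant `d`. -/
def hp (k : ℕ) (d : ℤ) (p : ℕ) (μ : ℕ) : ℤ :=
  if Even k then
    ∑ t ∈ Finset.range (2 * μ + 1),
      (jacobiSym ((-1) ^ (k / 2) * d) p) ^ t * (p : ℤ) ^ (((k - 2) / 2) * t)
  else
    ((p : ℤ) ^ ((k - 2) * (μ + 1)) - 1) / ((p : ℤ) ^ (k - 2) - 1) -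
      (p : ℤ) ^ ((k - 3) / 2) * jacobiSym ((-1) ^ ((k - 1) / 2) * (d / 2)) p *
        (((p : ℤ) ^ ((k - 2) * μ) - 1) / ((p : ℤ) ^ (k - 2) - 1))

/-- Almost strong s-regularity with respect to a finite set `P` of primes. -/
def AlmostSSRegular {k : ℕ} (a : Fin k → Fin k → ℤ) (P : Finset ℕ) : Prop :=
  ∀ n₁ n₂ : ℕ, 0 < n₁ → 0 < n₂ →
    (∀ p : ℕ, p.Prime → p ∣ n₁ → p ∈ P ∨ (p : ℤ) ∣ 2 * qfDisc a) →
    IsCoprime (n₂ : ℤ) (2 * qfDisc a) → (∀ p ∈ P, ¬ p ∣ n₂) →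
    (qfRep a (((n₁ : ℤ) * (n₂ : ℤ)) ^ 2) : ℤ) =
      (qfRep a ((n₁ : ℤ) ^ 2) : ℤ) *
        ∏ p ∈ n₂.primeFactors, hp k (qfDisc a) p (n₂.factorization p)

/-- Strong s-regularity: almost strong s-regularity with respect to the empty set. -/
def StronglySSRegular {k : ℕ} (a : Fin k → Fin k → ℤ) : Prop :=
  AlmostSSRegular a ∅

/-- The minimum of positive integers `n` such that `n²` is represented. -/
noncomputable def qfMs {k : ℕ} (a : Fin k → Fin k → ℤ) : ℕ :=
  sInf {n : ℕ | 0 < n ∧ qfRep a ((n : ℤ) ^ 2) ≠ 0}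

/-- `GL_k(ℤ)`-equivalence of quadratic forms of rank `k`. -/
def qfEquiv {k : ℕ} (a a' : Fin k → Fin k → ℤ) : Prop :=
  ∃ M : Matrix (Fin k) (Fin k) ℤ, IsUnit M.det ∧
    ∀ x : Fin k → ℤ, qfVal a' x = qfVal a (M.mulVec x)

/-- The polar form `(x, y) ↦ f (x + y) - f x - f y` of an integral quadratic form `f`. -/
def qfPolar {k : ℕ} (a : Fin k → Fin k → ℤ) :
    (Fin k → ℤ) →ₗ[ℤ] (Fin k → ℤ) →ₗ[ℤ] ℤ :=
  Matrix.toLinearMap₂' ℤ (qfHess a)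

theorem qfPolar_apply {k : ℕ} (a : Fin k → Fin k → ℤ) (x y : Fin k → ℤ) :
    qfPolar a x y = dotProduct x ((qfHess a).mulVec y) :=
  Matrix.toLinearMap₂'_apply' _ _ _

theorem qfPolar_self {k : ℕ} (a : Fin k → Fin k → ℤ) (x : Fin k → ℤ) :
    qfPolar a x x = 2 * qfVal a x := by
  have h : ∀ i j, x i * (qfHess a i j * x j) =
      (if i ≤ j then a i j * x i * x j else 0) + (if j ≤ i then a j i * x j * x i else 0) := by
    intro i j
    rcases lt_trichotomy i j with h | h | h
    · simp [qfHess, h.ne, h, h.le, not_le.2 h]; ring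
    · subst h; simp [qfHess]; ring
    · simp [qfHess, h.ne', not_lt.2 h.le, h.le, not_le.2 h]; ring
  have h2 : qfPolar a x x = ∑ i, ∑ j, x i * (qfHess a i j * x j) := by
    simp [qfPolar_apply, dotProduct, Matrix.mulVec, Finset.mul_sum]
  rw [h2]
  simp_rw [h, Finset.sum_add_distrib]
  rw [two_mul, qfVal]
  congr 1
  exact Finset.sum_comm

theorem qfPolar_comm {k : ℕ} (a : Fin k → Fin k → ℤ) (x y : Fin k → ℤ) :
    qfPolar a x y = qfPolar a y x := by
  have hT : (qfHess a).transpose = qfHess a := by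
    ext i j
    rcases lt_trichotomy i j with h | h | h
    · simp [qfHess, h.ne, h.ne', h, not_lt.2 h.le]
    · subst h; simp [qfHess]
    · simp [qfHess, h.ne, h.ne', h, not_lt.2 h.le]
  rw [qfPolar_apply, qfPolar_apply, Matrix.dotProduct_mulVec, dotProduct_comm,
    ← Matrix.mulVec_transpose, hT]

theorem qfVal_smul {k : ℕ} (a : Fin k → Fin k → ℤ) (c : ℤ) (x : Fin k → ℤ) :
    qfVal a (c • x) = c ^ 2 * qfVal a x := by
  have h1 := qfPolar_self a (c • x)
  have h2 := qfPolar_self a x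
  simp only [map_smul, LinearMap.smul_apply, smul_eq_mul, h2] at h1
  linarith

theorem qfVal_zero {k : ℕ} (a : Fin k → Fin k → ℤ) : qfVal a 0 = 0 := by
  simp [qfVal]

theorem qfVal_nonneg {k : ℕ} {a : Fin k → Fin k → ℤ} (ha : qfPosDef a) (x : Fin k → ℤ) :
    0 ≤ qfVal a x := by
  by_cases h : x = 0
  · simp [h, qfVal_zero]
  · exact (ha x h).le

theorem qfVal_sub_le {k : ℕ} {a : Fin k → Fin k → ℤ} (ha : qfPosDef a) (x y : Fin k → ℤ) :
    qfVal a (x - y) ≤ 2 * qfVal a x + 2 * qfVal a y := by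
  have h1 := qfPolar_self a (x - y)
  have h2 := qfPolar_self a (x + y)
  have h3 := qfPolar_self a x
  have h4 := qfPolar_self a y
  have h5 := qfVal_nonneg ha (x + y)
  simp only [map_add, map_sub, LinearMap.add_apply, LinearMap.sub_apply, h3, h4] at h1 h2
  linarith

theorem qfPolar_sq_le {k : ℕ} {a : Fin k → Fin k → ℤ} (ha : qfPosDef a) (x y : Fin k → ℤ) :
    qfPolar a x y ^ 2 ≤ 4 * qfVal a x * qfVal a y := by
  by_cases hy : y = 0
  · simp [hy, qfVal_zero]
  have hpos := ha y hy
  have h1 := qfPolar_self a (qfPolar a y y • x - qfPolar a x y • y)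
  have h5 := qfVal_nonneg ha (qfPolar a y y • x - qfPolar a x y • y)
  have h3 := qfPolar_self a x
  have h4 := qfPolar_self a y
  simp only [map_sub, LinearMap.sub_apply, map_smul, LinearMap.smul_apply, smul_eq_mul, h3, h4,
    qfPolar_comm a y x] at h1 h5
  by_contra hlt
  push Not at hlt
  nlinarith

theorem abs_qfPolar_le {k : ℕ} {a : Fin k → Fin k → ℤ} (ha : qfPosDef a) {x y : Fin k → ℤ}
    {c : ℤ} (hx : qfVal a x ≤ c ^ 2) (hy : qfVal a y ≤ c ^ 2) :
    |qfPolar a x y| ≤ 2 * c ^ 2 := by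
  have h := qfPolar_sq_le ha x y
  have hx0 := qfVal_nonneg ha x
  have hy0 := qfVal_nonneg ha y
  apply abs_le_of_sq_le_sq _ (by positivity)
  nlinarith [mul_le_mul hx hy hy0 (sq_nonneg c)]

theorem qfDisc_ne_zero {k : ℕ} {a : Fin k → Fin k → ℤ} (ha : qfPosDef a) : qfDisc a ≠ 0 := by
  intro h
  obtain ⟨v, hv, hv0⟩ := Matrix.exists_mulVec_eq_zero_iff.2 h
  have h1 := ha v hv
  have h2 := qfPolar_self a v
  rw [qfPolar_apply, hv0, dotProduct_zero] at h2
  omega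

theorem gram_eq_mul {k : ℕ} (a : Fin k → Fin k → ℤ) (v : Fin k → Fin k → ℤ) :
    (Matrix.of fun i j => qfPolar a (v i) (v j)) =
      Matrix.of v * qfHess a * (Matrix.of v).transpose := by
  ext i j
  rw [Matrix.of_apply, qfPolar_apply, Matrix.mul_assoc, Matrix.mul_apply]
  rfl

theorem det_gram_eq {k : ℕ} (a : Fin k → Fin k → ℤ) (v : Fin k → Fin k → ℤ) :
    (Matrix.of fun i j => qfPolar a (v i) (v j)).det =
      (Matrix.of v).det ^ 2 * qfDisc a := by
  rw [gram_eq_mul, Matrix.det_mul, Matrix.det_mul, Matrix.det_transpose, qfDisc]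
  ring

theorem abs_det_sq_mul_qfDisc_le {k : ℕ} {a : Fin k → Fin k → ℤ} (ha : qfPosDef a)
    (v : Fin k → Fin k → ℤ) {c : ℤ} (hv : ∀ i, qfVal a (v i) ≤ c ^ 2) :
    (Matrix.of v).det ^ 2 * |qfDisc a| ≤ (k.factorial : ℤ) * (2 * c ^ 2) ^ k := by
  have h := Matrix.det_le (abv := AbsoluteValue.abs)
    (A := Matrix.of fun i j => qfPolar a (v i) (v j)) (x := 2 * c ^ 2)
    (fun i j => abs_qfPolar_le ha (hv i) (hv j))
  rw [det_gram_eq] at h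
  simpa [AbsoluteValue.abs_apply, abs_mul] using h

theorem card_le_pow_finrank_of_sub_ne {k : ℕ} (Λ : Submodule ℤ (Fin k → ℤ)) (N : ℕ) [NeZero N]
    (S : Finset (Fin k → ℤ)) (hS : ∀ x ∈ S, x ∈ Λ)
    (hsep : ∀ x ∈ S, ∀ y ∈ S, ∀ u ∈ Λ, x - y = (N : ℤ) • u → x = y) :
    S.card ≤ N ^ Module.finrank ℤ Λ := by
  classical
  let b := Module.finBasis ℤ Λ
  let φ : S → (Fin (Module.finrank ℤ Λ) → ZMod N) :=
    fun x i => ((b.repr ⟨x.1, hS x.1 x.2⟩ i : ℤ) : ZMod N)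
  have hinj : Function.Injective φ := by
    intro x y hxy
    have hdvd : ∀ i, ∃ c : ℤ, b.repr ⟨x.1, hS x.1 x.2⟩ i - b.repr ⟨y.1, hS y.1 y.2⟩ i = N * c := by
      intro i
      have := congrFun hxy i
      have h2 := (ZMod.intCast_eq_intCast_iff_dvd_sub _ _ _).1 this.symm
      exact h2
    choose c hc using hdvd
    have key : (⟨x.1, hS x.1 x.2⟩ - ⟨y.1, hS y.1 y.2⟩ : Λ) = (N : ℤ) • ∑ i, c i • b i := by
      apply b.repr.injective
      ext i
      simp only [map_sub, map_smul, map_sum, Module.Basis.repr_self, Finsupp.sub_apply,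
        Finsupp.smul_apply, Finsupp.finsetSum_apply, smul_eq_mul]
      rw [hc i]
      simp [Finsupp.single_apply]
    apply Subtype.ext
    refine hsep x.1 x.2 y.1 y.2 (∑ i, c i • b i : Λ) (Submodule.coe_mem _) ?_
    have := congrArg (fun z : Λ => (z : Fin k → ℤ)) key
    simpa using this
  have := Fintype.card_le_of_injective φ hinj
  simpa [ZMod.card] using this

theorem finrank_ker_inf_ker_add_two_le {k : ℕ} (l g : (Fin k → ℤ) →ₗ[ℤ] ℤ) (hl : l ≠ 0)
    (v : Fin k → ℤ) (hlv : l v = 0) (hgv : g v ≠ 0) :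
    Module.finrank ℤ (LinearMap.ker (l.prod g)) + 2 ≤ k := by
  have h1 := (LinearMap.ker (l.prod g)).finrank_quotient_add_finrank
  rw [(LinearMap.quotKerEquivRange (l.prod g)).finrank_eq] at h1
  rw [Module.finrank_fin_fun] at h1
  obtain ⟨u, hu⟩ : ∃ u, l u ≠ 0 := by
    by_contra h
    push Not at h
    exact hl (LinearMap.ext h)
  have hli : LinearIndependent ℤ
      ![(l.prod g).rangeRestrict u, (l.prod g).rangeRestrict v] := by
    rw [LinearIndependent.pair_iff]
    intro s t hst
    have h2 : s • (l u, g u) + t • (l v, g v) = 0 := congrArg Subtype.val hst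
    simp only [hlv, Prod.smul_mk, Prod.mk_add_mk, smul_eq_mul, Prod.mk_eq_zero] at h2
    have hs : s = 0 := by simpa [hu] using h2.1
    refine ⟨hs, ?_⟩
    simpa [hs, hgv] using h2.2
  have h3 := hli.fintype_card_le_finrank
  simp only [Fintype.card_fin] at h3
  omega

theorem exists_det_ne_zero_or_exists_ker {k : ℕ} (W : Set (Fin k → ℤ)) :
    (∃ v : Fin k → Fin k → ℤ, (∀ i, v i ∈ W) ∧ (Matrix.of v).det ≠ 0) ∨
      ∃ l : (Fin k → ℤ) →ₗ[ℤ] ℤ, l ≠ 0 ∧ ∀ x ∈ W, l x = 0 := by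
  classical
  let c : (Fin k → ℤ) → (Fin k → ℚ) := fun x i => (x i : ℚ)
  by_cases htop : Submodule.span ℚ (c '' W) = ⊤
  · left
    obtain ⟨b, hbW, hbspan, hbli⟩ := exists_linearIndependent ℚ (c '' W)
    rw [htop] at hbspan
    let B := Module.Basis.mk hbli (by simp [hbspan])
    have : Fintype b := Module.Basis.fintypeIndexOfRankLtAleph0 B
      (by exact Module.rank_lt_aleph0 ℚ (Fin k → ℚ))
    have hcard : Fintype.card b = Fintype.card (Fin k) := by
      rw [← Module.finrank_eq_card_basis B]; simp
    let e := Fintype.equivOfCardEq hcard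
    have hmem : ∀ i : Fin k, ∃ w ∈ W, c w = (e.symm i : Fin k → ℚ) := fun i => hbW (e.symm i).2
    choose v hvW hv using hmem
    refine ⟨v, hvW, ?_⟩
    have hli2 : LinearIndependent ℚ (fun i => c (v i)) := by
      have := hbli.comp e.symm e.symm.injective
      have hfun : (fun i => c (v i)) = Subtype.val ∘ e.symm := funext hv
      rw [hfun]
      exact this
    have h3 := (Matrix.linearIndependent_rows_iff_isUnit
      (A := (Matrix.of v).map (Int.cast : ℤ → ℚ))).1 hli2
    rw [Matrix.isUnit_iff_isUnit_det] at h3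
    intro h0
    have h4 : ((Matrix.of v).map (Int.cast : ℤ → ℚ)).det = ((Matrix.of v).det : ℤ) := by
      simpa using ((Int.castRingHom ℚ).map_det (Matrix.of v)).symm
    rw [h4, h0] at h3
    simp at h3
  · right
    obtain ⟨g, hg0, hg⟩ := Submodule.exists_le_ker_of_lt_top _ (lt_top_iff_ne_top.2 htop)
    obtain ⟨d, hd⟩ := IsLocalization.exist_integer_multiples_of_finite (nonZeroDivisors ℤ)
      (fun i : Fin k => g (Pi.single i 1))
    choose z hz using hd
    have hd0 : ((d : ℤ) : ℚ) ≠ 0 := by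
      have := nonZeroDivisors.ne_zero d.2
      exact_mod_cast this
    have hz' : ∀ i, (z i : ℚ) = (d : ℤ) * g (Pi.single i 1) := by
      intro i
      have := hz i
      simpa using this
    have hsum : ∀ x : Fin k → ℤ, ((∑ i, x i * z i : ℤ) : ℚ) = (d : ℤ) * g (c x) := by
      intro x
      have : c x = ∑ i, (x i : ℚ) • (Pi.single i 1 : Fin k → ℚ) := by
        ext j
        simp [c, Finset.sum_apply, Pi.single_apply]
      rw [this, map_sum, Finset.mul_sum]
      push_cast
      refine Finset.sum_congr rfl fun i _ => ?_
      rw [hz', map_smul, smul_eq_mul]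
      ring
    refine ⟨Fintype.linearCombination ℤ z, ?_, ?_⟩
    · intro h
      apply hg0
      refine LinearMap.pi_ext' fun i => LinearMap.ext_ring ?_
      have h1 : Fintype.linearCombination ℤ z (Pi.single i 1) = 0 := by rw [h]; rfl
      have h2 : z i = 0 := by simpa using h1
      have h3 := hz' i
      rw [h2] at h3
      have h4 : g (Pi.single i 1) = 0 := by
        simpa [hd0] using h3.symm
      simpa using h4
    · intro x hx
      have h1 : g (c x) = 0 := hg (Submodule.subset_span ⟨x, hx, rfl⟩)
      have h2 := hsum x
      rw [h1, mul_zero] at h2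
      rw [Fintype.linearCombination_apply]
      exact_mod_cast h2

theorem exists_card_divisors_pow_le {e : ℕ} (he : 0 < e) :
    ∃ C : ℕ, 0 < C ∧ ∀ n : ℕ, n ≠ 0 → n.divisors.card ^ e ≤ C * n := by
  have h1 : ∀ r : ℕ, (r + 1) ^ e ≤ e ^ e * 2 ^ r := by
    intro r
    have h2 : r + 1 ≤ e * 2 ^ (r / e) := by
      have h3 : r / e + 1 ≤ 2 ^ (r / e) := Nat.lt_two_pow_self
      have h4 := Nat.lt_div_mul_add (a := r) he
      calc r + 1 ≤ e * (r / e + 1) := by rw [mul_add, mul_comm e]; omega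
        _ ≤ _ := Nat.mul_le_mul_left _ h3
    calc (r + 1) ^ e ≤ (e * 2 ^ (r / e)) ^ e := Nat.pow_le_pow_left h2 _
      _ = e ^ e * 2 ^ (r / e * e) := by rw [mul_pow, pow_mul]
      _ ≤ _ := Nat.mul_le_mul_left _ (Nat.pow_le_pow_right (by norm_num) (Nat.div_mul_le_self _ _))
  have hee : 1 ≤ e ^ e := Nat.one_le_pow _ _ he
  let c : ℕ → ℕ := fun p => if p < 2 ^ e then e ^ e else 1
  have hc1 : ∀ p, 1 ≤ c p := by
    intro p; dsimp only [c]; split_ifs <;> omega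
  have hc : ∀ p r : ℕ, 2 ≤ p → (r + 1) ^ e ≤ c p * p ^ r := by
    intro p r hp
    dsimp only [c]
    split_ifs with h
    · exact (h1 r).trans (Nat.mul_le_mul_left _ (Nat.pow_le_pow_left hp _))
    · push Not at h
      have h3 : r + 1 ≤ 2 ^ r := Nat.lt_two_pow_self
      calc (r + 1) ^ e ≤ (2 ^ r) ^ e := Nat.pow_le_pow_left h3 _
        _ = (2 ^ e) ^ r := by rw [← pow_mul, ← pow_mul, mul_comm]
        _ ≤ _ := by rw [one_mul]; exact Nat.pow_le_pow_left h _
  refine ⟨∏ p ∈ Finset.range (2 ^ e), c p, Finset.prod_pos fun p _ => hc1 p, fun n hn => ?_⟩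
  rw [Nat.card_divisors hn, ← Finset.prod_pow]
  calc ∏ p ∈ n.primeFactors, (n.factorization p + 1) ^ e
      ≤ ∏ p ∈ n.primeFactors, c p * p ^ n.factorization p :=
        Finset.prod_le_prod' fun p hp => hc _ _ (Nat.prime_of_mem_primeFactors hp).two_le
    _ = (∏ p ∈ n.primeFactors, c p) * n := by
        rw [Finset.prod_mul_distrib]
        congr 1
        exact Nat.prod_factorization_pow_eq_self hn
    _ ≤ _ := by
        refine Nat.mul_le_mul_right _ ?_
        have h5 : ∏ p ∈ n.primeFactors with p < 2 ^ e, c p = ∏ p ∈ n.primeFactors, c p := by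
          apply Finset.prod_filter_of_ne
          intro p _ hp
          by_contra h
          exact hp (by simp [c, h])
        rw [← h5]
        refine Finset.prod_le_prod_of_subset_of_one_le' ?_ fun p _ _ => hc1 p
        intro p hp
        simpa using (Finset.mem_filter.1 hp).2

theorem exists_mul_pow_le_primeCounting (s : ℕ) :
    ∃ T : ℕ, ∀ t : ℕ, T ≤ t → 3 * t ^ s ≤ Nat.primeCounting (t ^ (s + 1)) := by
  have hlog : ∀ᶠ t : ℕ in Filter.atTop,
      Real.log t ≤ (Real.log 2 / (5 * (s + 1))) * t := by
    have h2 : 0 < Real.log 2 / (5 * ((s : ℝ) + 1)) := by positivity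
    have h1 := (Real.isLittleO_log_id_atTop.bound h2).natCast_atTop
    filter_upwards [h1, Filter.eventually_ge_atTop 1] with t ht ht1
    simp only [id, Real.norm_eq_abs, Nat.abs_cast] at ht
    exact (le_abs_self _).trans ht
  obtain ⟨T, hT⟩ := Filter.eventually_atTop.1 (hlog.and (Filter.eventually_ge_atTop 2))
  refine ⟨T, fun t ht => ?_⟩
  obtain ⟨h1, h2⟩ := hT t ht
  have ht2 : (2 : ℝ) ≤ t := by exact_mod_cast h2
  have h3 := Chebyshev.pi_ge (t ^ (s + 1))
  have hlt : 0 < Real.log t := Real.log_pos (by linarith)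
  have hpow : (1 : ℝ) ≤ (t : ℝ) ^ s := one_le_pow₀ (by linarith)
  have hn2 : (2 : ℝ) ≤ (t : ℝ) ^ (s + 1) := by
    rw [pow_succ]; nlinarith
  have hn : Real.log (((t ^ (s + 1) : ℕ) : ℝ)) = (s + 1) * Real.log t := by
    push_cast
    rw [Real.log_pow]
    push_cast
    ring
  have hn1 : Real.log (((t ^ (s + 1) : ℕ) : ℝ) + 1) ≤ 2 * ((s + 1) * Real.log t) := by
    rw [← hn, two_mul, ← Real.log_mul (by positivity) (by positivity)]
    apply Real.log_le_log (by positivity)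
    push_cast
    nlinarith
  have hnpos : 0 < ((s : ℝ) + 1) * Real.log t := by positivity
  have key : (3 : ℝ) * t ^ s ≤
      (((t ^ (s + 1) : ℕ) : ℝ) * Real.log 2 - Real.log (((t ^ (s + 1) : ℕ) : ℝ) + 1)) /
        Real.log (((t ^ (s + 1) : ℕ) : ℝ)) := by
    rw [hn, le_div_iff₀ hnpos]
    have h5 : 5 * (((s : ℝ) + 1) * Real.log t) ≤ Real.log 2 * t := by
      have := mul_le_mul_of_nonneg_left h1 (show (0 : ℝ) ≤ 5 * (s + 1) by positivity)
      have h6 : 5 * ((s : ℝ) + 1) * (Real.log 2 / (5 * (s + 1)) * t) = Real.log 2 * t := by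
        field_simp
      linarith
    have h7 := mul_le_mul_of_nonneg_left h5 (show (0 : ℝ) ≤ (t : ℝ) ^ s by positivity)
    have h8 : ((t ^ (s + 1) : ℕ) : ℝ) * Real.log 2 = (t : ℝ) ^ s * (Real.log 2 * t) := by
      push_cast; ring
    rw [h8]
    nlinarith
  have := key.trans h3
  exact_mod_cast this

theorem pow_le_two_mul_hp {k : ℕ} (hk : 3 ≤ k) {d : ℤ} {q : ℕ} (hq : q.Prime)
    (hqd : IsCoprime (q : ℤ) (2 * d)) : (q : ℤ) ^ (k - 2) ≤ 2 * hp k d q 1 := by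
  have hq2 : (2 : ℤ) ≤ q := by exact_mod_cast hq.two_le
  have hqd' : IsCoprime d (q : ℤ) := (IsCoprime.of_mul_right_right hqd).symm
  rw [hp]
  split_ifs with hev
  · obtain ⟨r, rfl⟩ := hev
    have hcop : IsCoprime ((-1) ^ ((r + r) / 2) * d) (q : ℤ) :=
      IsCoprime.mul_left isCoprime_one_left.neg_left.pow_left hqd'
    have h1 := jacobiSym.eq_one_or_neg_one (Int.isCoprime_iff_gcd_eq_one.1 hcop)
    have h2 : r + r - 2 = (r + r - 2) / 2 * 2 := by omega
    set y := (q : ℤ) ^ ((r + r - 2) / 2) with hy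
    have hy1 : 0 < y := by positivity
    have h3 : (q : ℤ) ^ (r + r - 2) = y ^ 2 := by rw [hy, ← pow_mul, ← h2]
    rw [h3]
    simp only [Finset.sum_range_succ, Finset.sum_range_zero, mul_one, pow_mul]
    rw [← hy]
    rcases h1 with h1 | h1 <;> rw [h1] <;> nlinarith [sq_nonneg (y - 1)]
  · set z := (q : ℤ) ^ ((k - 3) / 2) with hz
    have hz0 : 0 < z := by positivity
    have hzq : q * z ≤ (q : ℤ) ^ (k - 2) := by
      rw [hz, ← pow_succ']
      exact pow_le_pow_right₀ (by linarith) (by omega)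
    set w := (q : ℤ) ^ (k - 2) with hw
    have hw2 : 1 < w := by nlinarith
    have e1 : (q : ℤ) ^ ((k - 2) * (1 + 1)) - 1 = (w - 1) * (w + 1) := by
      rw [pow_mul]; ring
    have e2 : (q : ℤ) ^ ((k - 2) * 1) - 1 = w - 1 := by rw [mul_one]
    rw [e1, e2, Int.mul_ediv_cancel_left _ (by omega), Int.ediv_self (by omega), mul_one]
    rcases jacobiSym.trichotomy ((-1) ^ ((k - 1) / 2) * (d / 2)) q with h | h | h <;>
      rw [h] <;> nlinarith

theorem exists_eq_mul_of_primes {D : ℤ} {m : ℕ} (hm : 0 < m) :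
    ∃ n₁ n₂ : ℕ, m = n₁ * n₂ ∧ 0 < n₁ ∧ 0 < n₂ ∧
      (∀ p : ℕ, p.Prime → p ∣ n₁ → (p : ℤ) ∣ D) ∧ IsCoprime (n₂ : ℤ) D := by
  induction m using induction_on_primes with
  | zero => exact absurd hm (lt_irrefl 0)
  | one =>
    refine ⟨1, 1, rfl, one_pos, one_pos, fun p hp h => ?_, by simpa using isCoprime_one_left⟩
    exact absurd (Nat.dvd_one.1 h) hp.ne_one
  | prime_mul p a hp ih =>
    obtain ⟨n₁, n₂, h, h1, h2, h3, h4⟩ := ih (Nat.pos_of_mul_pos_left hm)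
    by_cases hpD : (p : ℤ) ∣ D
    · refine ⟨p * n₁, n₂, by rw [h, mul_assoc], Nat.mul_pos hp.pos h1, h2, fun r hr hrd => ?_, h4⟩
      rcases (Nat.Prime.dvd_mul hr).1 hrd with h5 | h5
      · rwa [(Nat.prime_dvd_prime_iff_eq hr hp).1 h5]
      · exact h3 r hr h5
    · refine ⟨n₁, p * n₂, by rw [h]; ring, h1, Nat.mul_pos hp.pos h2, h3, ?_⟩
      push_cast
      exact IsCoprime.mul_left (((Nat.prime_iff_prime_int.1 hp).coprime_iff_not_dvd).2 hpD) h4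

/-- The scaled orthogonal projection `2 f(v) x - B(x, v) v` away from `v`, where `B` is the polar
form of `f`. -/
def qfProj {k : ℕ} (a : Fin k → Fin k → ℤ) (v x : Fin k → ℤ) : Fin k → ℤ :=
  (2 * qfVal a v) • x - qfPolar a x v • v

theorem qfVal_qfProj {k : ℕ} (a : Fin k → Fin k → ℤ) (v x : Fin k → ℤ) :
    qfVal a (qfProj a v x) = qfVal a v * (4 * qfVal a v * qfVal a x - qfPolar a x v ^ 2) := by
  have h1 := qfPolar_self a (qfProj a v x)
  have h3 := qfPolar_self a x
  have h4 := qfPolar_self a v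
  rw [qfProj] at h1 ⊢
  simp only [map_sub, LinearMap.sub_apply, map_smul, LinearMap.smul_apply, smul_eq_mul, h3, h4,
    qfPolar_comm a v x] at h1
  linarith

theorem qfPolar_qfProj {k : ℕ} (a : Fin k → Fin k → ℤ) (v x : Fin k → ℤ) :
    qfPolar a (qfProj a v x) v = 0 := by
  have h4 := qfPolar_self a v
  simp only [qfProj, map_sub, LinearMap.sub_apply, map_smul, LinearMap.smul_apply, smul_eq_mul, h4]
  ring

theorem eq_or_eq_neg_of_qfProj_eq_zero {k : ℕ} {a : Fin k → Fin k → ℤ} {m q : ℕ} (hm : 0 < m)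
    {v x : Fin k → ℤ} (hv : qfVal a v = (m : ℤ) ^ 2) (hx : qfVal a x = ((m : ℤ) * q) ^ 2)
    (h0 : qfProj a v x = 0) : x = (q : ℤ) • v ∨ x = (-(q : ℤ)) • v := by
  have h1 := qfVal_qfProj a v x
  have hm' : (0 : ℤ) < m := by exact_mod_cast hm
  rw [h0, qfVal_zero, hv, hx] at h1
  have h2 : qfPolar a x v ^ 2 = (2 * (m : ℤ) ^ 2 * q) ^ 2 := by
    rcases mul_eq_zero.1 h1.symm with h | h
    · exact absurd h (by positivity)
    · linarith
  have h3 : (2 * (m : ℤ) ^ 2) • x = qfPolar a x v • v := by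
    rw [qfProj, hv] at h0
    exact sub_eq_zero.1 h0
  have hinj := smul_right_injective (Fin k → ℤ) (show (2 * (m : ℤ) ^ 2) ≠ 0 by positivity)
  rcases sq_eq_sq_iff_eq_or_eq_neg.1 h2 with h | h
  · left
    apply hinj
    simp only
    rw [h3, h, smul_smul]
  · right
    apply hinj
    simp only
    rw [h3, h, smul_smul, mul_neg]

theorem card_fiber_qfProj_le {k : ℕ} {a : Fin k → Fin k → ℤ} (ha : qfPosDef a) {m : ℕ}
    (hm : 0 < m) {v : Fin k → ℤ} (hv : qfVal a v = (m : ℤ) ^ 2) {X d : ℕ}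
    (hd : ∀ n : ℕ, n ≠ 0 → n ≤ 4 * m ^ 4 * X ^ 2 → n.divisors.card ≤ d)
    (y : Fin k → ℤ) (hy : y ≠ 0) (U : Finset (Σ _ : ℕ, Fin k → ℤ))
    (hU : ∀ u ∈ U, u.1 ≤ X ∧ qfVal a u.2 = ((m : ℤ) * u.1) ^ 2 ∧ qfProj a v u.2 = y) :
    U.card ≤ d := by
  have hm' : (0 : ℤ) < m := by exact_mod_cast hm
  rcases U.eq_empty_or_nonempty with rfl | ⟨u₀, hu₀⟩
  · simp
  have hval : ∀ u ∈ U, qfVal a y = (m : ℤ) ^ 2 *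
      ((2 * (m : ℤ) ^ 2 * u.1 - qfPolar a u.2 v) * (2 * (m : ℤ) ^ 2 * u.1 + qfPolar a u.2 v)) := by
    intro u hu
    obtain ⟨-, h2, h3⟩ := hU u hu
    rw [← h3, qfVal_qfProj, hv, h2]
    ring
  have hypos := ha y hy
  obtain ⟨D, hD⟩ : ∃ D : ℕ, qfVal a y = (m : ℤ) ^ 2 * D := by
    have h := hval u₀ hu₀
    have h0 : 0 < (2 * (m : ℤ) ^ 2 * u₀.1 - qfPolar a u₀.2 v) *
        (2 * (m : ℤ) ^ 2 * u₀.1 + qfPolar a u₀.2 v) := by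
      rw [h] at hypos
      exact pos_of_mul_pos_right hypos (by positivity)
    refine ⟨((2 * (m : ℤ) ^ 2 * u₀.1 - qfPolar a u₀.2 v) *
        (2 * (m : ℤ) ^ 2 * u₀.1 + qfPolar a u₀.2 v)).toNat, ?_⟩
    rw [Int.toNat_of_nonneg h0.le, h]
  have hDpos : (0 : ℤ) < D := by
    rw [hD] at hypos
    exact pos_of_mul_pos_right hypos (by positivity)
  have hmul : ∀ u ∈ U, (2 * (m : ℤ) ^ 2 * u.1 - qfPolar a u.2 v) *
      (2 * (m : ℤ) ^ 2 * u.1 + qfPolar a u.2 v) = D := by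
    intro u hu
    have h := hval u hu
    rw [hD] at h
    exact (mul_left_cancel₀ (by positivity) h).symm
  have hpos : ∀ u ∈ U, 0 < 2 * (m : ℤ) ^ 2 * u.1 - qfPolar a u.2 v := by
    intro u hu
    have h := hmul u hu
    by_contra hle
    push Not at hle
    have h2 : (0 : ℤ) ≤ 2 * (m : ℤ) ^ 2 * u.1 := by positivity
    nlinarith
  have hDle : D ≤ 4 * m ^ 4 * X ^ 2 := by
    have h := hmul u₀ hu₀
    have h2 : (u₀.1 : ℤ) ≤ X := by exact_mod_cast (hU u₀ hu₀).1
    have h3 : (u₀.1 : ℤ) ^ 2 ≤ (X : ℤ) ^ 2 := pow_le_pow_left₀ (by positivity) h2 2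
    have h4 : (D : ℤ) ≤ 4 * (m : ℤ) ^ 4 * (X : ℤ) ^ 2 := by
      nlinarith [sq_nonneg (qfPolar a u₀.2 v),
        mul_le_mul_of_nonneg_left h3 (show (0 : ℤ) ≤ 4 * (m : ℤ) ^ 4 by positivity)]
    exact_mod_cast h4
  have hDne : D ≠ 0 := by
    rintro rfl
    exact lt_irrefl _ hDpos
  refine le_trans ?_ (hd D hDne hDle)
  refine Finset.card_le_card_of_injOn
    (fun u => (2 * (m : ℤ) ^ 2 * u.1 - qfPolar a u.2 v).toNat) ?_ ?_
  · intro u hu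
    simp only [Finset.mem_coe, Nat.mem_divisors]
    refine ⟨?_, hDne⟩
    rw [← Int.natCast_dvd_natCast, Int.toNat_of_nonneg (hpos u hu).le]
    exact ⟨_, (hmul u hu).symm⟩
  · intro u hu w hw huw
    have hu1 := hmul u hu
    have hw1 := hmul w hw
    have h1 : 2 * (m : ℤ) ^ 2 * u.1 - qfPolar a u.2 v = 2 * (m : ℤ) ^ 2 * w.1 - qfPolar a w.2 v := by
      have := congrArg (Nat.cast : ℕ → ℤ) huw
      simpa only [Int.toNat_of_nonneg (hpos u hu).le, Int.toNat_of_nonneg (hpos w hw).le] using this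
    have h2 : 2 * (m : ℤ) ^ 2 * u.1 + qfPolar a u.2 v = 2 * (m : ℤ) ^ 2 * w.1 + qfPolar a w.2 v := by
      rw [← hw1, h1] at hu1
      exact mul_left_cancel₀ (hpos w hw).ne' hu1
    have h3 : qfPolar a u.2 v = qfPolar a w.2 v := by linarith
    have h4 : (u.1 : ℤ) = w.1 :=
      mul_left_cancel₀ (show 2 * (m : ℤ) ^ 2 ≠ 0 by positivity) (by linarith)
    have h5 : u.2 = w.2 := by
      have h6 := (hU u hu).2.2.trans (hU w hw).2.2.symm
      rw [qfProj, qfProj, h3, hv] at h6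
      exact smul_right_injective (Fin k → ℤ) (show (2 * (m : ℤ) ^ 2) ≠ 0 by positivity)
        (sub_left_injective h6)
    obtain ⟨n, x⟩ := u
    obtain ⟨n', x'⟩ := w
    simp only at h4 h5
    rw [h5, Nat.cast_injective h4]

theorem card_le_of_hyperplane {k : ℕ} {a : Fin k → Fin k → ℤ} (ha : qfPosDef a) {m : ℕ}
    (hm : 0 < m) {v : Fin k → ℤ} (hv : qfVal a v = (m : ℤ) ^ 2) {X d : ℕ}
    (hd : ∀ n : ℕ, n ≠ 0 → n ≤ 4 * m ^ 4 * X ^ 2 → n.divisors.card ≤ d)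
    {l : (Fin k → ℤ) →ₗ[ℤ] ℤ} (hl : l ≠ 0) (hlv : l v = 0)
    (U : Finset (Σ _ : ℕ, Fin k → ℤ))
    (hU : ∀ u ∈ U, u.1 ≤ X ∧ qfVal a u.2 = ((m : ℤ) * u.1) ^ 2 ∧ l u.2 = 0 ∧
      qfProj a v u.2 ≠ 0) :
    U.card ≤ d * (4 * m ^ 3 * X + 1) ^ (k - 2) := by
  classical
  have hm' : (0 : ℤ) < m := by exact_mod_cast hm
  have hgv : (qfPolar a).flip v v ≠ 0 := by
    rw [LinearMap.flip_apply, qfPolar_self, hv]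
    positivity
  have hrank := finrank_ker_inf_ker_add_two_le l ((qfPolar a).flip v) hl v hlv hgv
  set Λ := LinearMap.ker (l.prod ((qfPolar a).flip v))
  refine (Finset.card_le_mul_card_image (f := fun u => qfProj a v u.2) U d ?_).trans
    (Nat.mul_le_mul_left _ ?_)
  · intro y hy
    obtain ⟨u, hu, rfl⟩ := Finset.mem_image.1 hy
    refine card_fiber_qfProj_le ha hm hv hd _ (hU u hu).2.2.2 _ fun w hw => ?_
    obtain ⟨hw1, hw2⟩ := Finset.mem_filter.1 hw
    exact ⟨(hU w hw1).1, (hU w hw1).2.1, hw2⟩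
  · refine le_trans (card_le_pow_finrank_of_sub_ne Λ (4 * m ^ 3 * X + 1) _ ?_ ?_)
      (Nat.pow_le_pow_right (Nat.succ_pos _) (by omega))
    · intro y hy
      obtain ⟨u, hu, rfl⟩ := Finset.mem_image.1 hy
      rw [LinearMap.mem_ker, LinearMap.prod_apply]
      refine Prod.ext ?_ (qfPolar_qfProj a v u.2)
      change l (qfProj a v u.2) = 0
      rw [qfProj, map_sub, map_smul, map_smul, (hU u hu).2.2.1, hlv, smul_zero, smul_zero, sub_zero]
    · have hbd : ∀ y ∈ U.image (fun u => qfProj a v u.2),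
          qfVal a y ≤ 4 * (m : ℤ) ^ 6 * (X : ℤ) ^ 2 := by
        intro y hy
        obtain ⟨u, hu, rfl⟩ := Finset.mem_image.1 hy
        obtain ⟨h1, h2, -, -⟩ := hU u hu
        rw [qfVal_qfProj, hv, h2]
        have h3 : (u.1 : ℤ) ≤ X := by exact_mod_cast h1
        have h4 : (u.1 : ℤ) ^ 2 ≤ (X : ℤ) ^ 2 := pow_le_pow_left₀ (by positivity) h3 2
        have h5 := mul_le_mul_of_nonneg_left h4 (show (0 : ℤ) ≤ 4 * (m : ℤ) ^ 6 by positivity)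
        have h6 : 0 ≤ (m : ℤ) ^ 2 * qfPolar a u.2 v ^ 2 := by positivity
        linarith
      intro x hx y hy z _ hz
      have h1 := qfVal_sub_le ha x y
      rw [hz, qfVal_smul] at h1
      have h2 := hbd x hx
      have h3 := hbd y hy
      by_contra hxy
      have hz0 : z ≠ 0 := by
        rintro rfl
        rw [smul_zero] at hz
        exact hxy (sub_eq_zero.1 hz)
      have h4 := ha z hz0
      push_cast at h1
      have h5 : (4 * (m : ℤ) ^ 3 * X + 1) ^ 2 ≤ (4 * (m : ℤ) ^ 3 * X + 1) ^ 2 * qfVal a z :=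
        le_mul_of_one_le_right (by positivity) h4
      have h6 : 0 ≤ (m : ℤ) ^ 3 * X := by positivity
      nlinarith

theorem dvd_two_mul_qfDisc_of_dvd_qfMs {k : ℕ} {a : Fin k → Fin k → ℤ} (hreg : StronglySSRegular a)
    {m : ℕ} (hm : 0 < m) (hrep : qfRep a ((m : ℤ) ^ 2) ≠ 0) (hms : qfMs a = m)
    {p : ℕ} (hp : p.Prime) (hpm : p ∣ m) : (p : ℤ) ∣ 2 * qfDisc a := by
  obtain ⟨n₁, n₂, h, h1, h2, h3, h4⟩ := exists_eq_mul_of_primes (D := 2 * qfDisc a) hm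
  have h5 := hreg n₁ n₂ h1 h2 (fun r hr hrn => Or.inr (h3 r hr hrn)) h4 (by simp)
  have h6 : qfRep a ((n₁ : ℤ) ^ 2) ≠ 0 := by
    intro h0
    rw [h0, Nat.cast_zero, zero_mul, ← Nat.cast_mul, ← h] at h5
    exact hrep (by exact_mod_cast h5)
  have h7 : m ≤ n₁ := hms ▸ Nat.sInf_le ⟨h1, h6⟩
  have h8 : n₂ = 1 := by
    rw [h] at h7
    have := Nat.le_of_mul_le_mul_left (h7.trans_eq (mul_one n₁).symm) h1
    omega
  rw [h, h8, mul_one] at hpm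
  exact h3 p hp hpm

theorem pow_le_two_mul_qfRep {k : ℕ} (hk : 3 ≤ k) {a : Fin k → Fin k → ℤ}
    (hreg : StronglySSRegular a) {m : ℕ} (hm : 0 < m) (hrep : qfRep a ((m : ℤ) ^ 2) ≠ 0)
    (hms : qfMs a = m) {q : ℕ} (hq : q.Prime) (hqd : IsCoprime (q : ℤ) (2 * qfDisc a)) :
    q ^ (k - 2) ≤ 2 * qfRep a (((m : ℤ) * q) ^ 2) := by
  have h1 := hreg m q hm hq.pos
    (fun p hp hpm => Or.inr (dvd_two_mul_qfDisc_of_dvd_qfMs hreg hm hrep hms hp hpm)) hqd (by simp)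
  rw [hq.primeFactors, Finset.prod_singleton, hq.factorization_self] at h1
  have h2 := pow_le_two_mul_hp hk hq hqd
  have h3 : (1 : ℤ) ≤ qfRep a ((m : ℤ) ^ 2) := by exact_mod_cast Nat.one_le_iff_ne_zero.2 hrep
  have h4 : (0 : ℤ) < (q : ℤ) ^ (k - 2) := pow_pos (by exact_mod_cast hq.pos) _
  have h5 : (q : ℤ) ^ (k - 2) ≤ 2 * qfRep a (((m : ℤ) * q) ^ 2) := by
    rw [h1]
    nlinarith
  exact_mod_cast h5

theorem exists_hyperplane_bound (r m : ℕ) (hm : 0 < m) :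
    ∃ T : ℕ, ∀ t : ℕ, T ≤ t → ∀ a : Fin (r + 3) → Fin (r + 3) → ℤ, qfPosDef a →
      StronglySSRegular a → qfRep a ((m : ℤ) ^ 2) ≠ 0 → qfMs a = m →
      (2 * qfDisc a).natAbs.primeFactors.card ≤ t →
      ∀ l : (Fin (r + 3) → ℤ) →ₗ[ℤ] ℤ,
        (∀ x, qfVal a x ≤ ((m * t ^ (2 * r + 4) : ℕ) : ℤ) ^ 2 → l x = 0) → l = 0 := by
  classical
  obtain ⟨C, hC0, hC⟩ := exists_card_divisors_pow_le (e := 8) (by norm_num)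
  obtain ⟨T₁, hT₁⟩ := exists_mul_pow_le_primeCounting (2 * r + 3)
  obtain ⟨K, hK⟩ : ∃ K, K = 4 * (5 * m ^ 3) ^ (r + 1) := ⟨_, rfl⟩
  have hK0 : 0 < K := by rw [hK]; positivity
  refine ⟨T₁ + K ^ 8 * (C * (4 * m ^ 4)) + 8, fun t ht a ha hreg hrep hms hω l hl => ?_⟩
  by_contra hl0
  obtain ⟨X, hX⟩ : ∃ X, X = t ^ (2 * r + 4) := ⟨_, rfl⟩
  have ht1 : 1 ≤ t := by omega
  have hX1 : 1 ≤ X := by rw [hX]; exact Nat.one_le_pow _ _ ht1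
  have hm' : (1 : ℤ) ≤ m := by exact_mod_cast hm
  obtain ⟨v, hv⟩ : ∃ v, qfVal a v = (m : ℤ) ^ 2 := Set.nonempty_of_ncard_ne_zero hrep
  rw [← hX] at hl
  have hlv : l v = 0 := by
    apply hl
    rw [hv]
    apply pow_le_pow_left₀ (by positivity)
    push_cast
    have : (1 : ℤ) ≤ X := by exact_mod_cast hX1
    nlinarith
  -- primes of size about `X` not dividing the discriminant
  let P : Finset ℕ := (Nat.primesLE X).filter
    fun q => t ^ (2 * r + 3) < q ∧ ¬ (q : ℤ) ∣ 2 * qfDisc a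
  have hPcard : t ^ (2 * r + 3) ≤ P.card := by
    have h1 : Nat.primesLE X ⊆
        P ∪ (Finset.range (t ^ (2 * r + 3) + 1) ∪ (2 * qfDisc a).natAbs.primeFactors) := by
      intro q hq
      simp only [P, Finset.mem_union, Finset.mem_filter, hq, true_and, Finset.mem_range]
      by_cases h2 : t ^ (2 * r + 3) < q
      · by_cases h3 : (q : ℤ) ∣ 2 * qfDisc a
        · right; right
          refine Nat.mem_primeFactors.2 ⟨(Nat.mem_primesLE.1 hq).2, Int.natCast_dvd.1 h3, ?_⟩
          have := qfDisc_ne_zero ha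
          simpa using this
        · exact Or.inl ⟨h2, h3⟩
      · right; left; omega
    have h2 := (Finset.card_le_card h1).trans ((Finset.card_union_le _ _).trans
      (Nat.add_le_add_left (Finset.card_union_le _ _) _))
    have h3 : (Nat.primesLE X).card = Nat.primeCounting X := by
      simp [Nat.primesLE_card_eq_primeCounting]
    have h4 := hT₁ t (by omega)
    rw [← hX, ← h3] at h4
    rw [Finset.card_range] at h2
    have h5 : t ≤ t ^ (2 * r + 2) := Nat.le_self_pow (by omega) t
    have h6 : 8 * t ^ (2 * r + 2) ≤ t ^ (2 * r + 3) := by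
      rw [pow_succ' t (2 * r + 2)]
      exact Nat.mul_le_mul_right _ (by omega)
    omega
  have hfin : ∀ q ∈ P, {x | qfVal a x = ((m : ℤ) * q) ^ 2}.Finite ∧
      t ^ ((2 * r + 3) * (r + 1)) ≤ 2 * {x | qfVal a x = ((m : ℤ) * q) ^ 2}.ncard := by
    intro q hq
    obtain ⟨hq1, hq2, hq3⟩ := Finset.mem_filter.1 hq
    have hqp := (Nat.mem_primesLE.1 hq1).2
    have h1 := pow_le_two_mul_qfRep (by omega) hreg hm hrep hms hqp
      (((Nat.prime_iff_prime_int.1 hqp).coprime_iff_not_dvd).2 hq3)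
    have h2 : t ^ ((2 * r + 3) * (r + 1)) ≤ q ^ (r + 3 - 2) := by
      rw [pow_mul]
      exact Nat.pow_le_pow_left hq2.le _
    refine ⟨Set.finite_of_ncard_pos ?_, h2.trans h1⟩
    have h3 := pow_pos hqp.pos (r + 3 - 2)
    rw [qfRep] at h1
    omega
  let F : ℕ → Finset (Fin (r + 3) → ℤ) := fun q =>
    if hq : q ∈ P then (hfin q hq).1.toFinset.filter (fun x => qfProj a v x ≠ 0) else ∅
  have hF : ∀ q ∈ P, ∀ x, x ∈ F q ↔ qfVal a x = ((m : ℤ) * q) ^ 2 ∧ qfProj a v x ≠ 0 := by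
    intro q hq x
    simp [F, hq]
  have hFcard : ∀ q ∈ P, t ^ ((2 * r + 3) * (r + 1)) ≤ 4 * (F q).card := by
    intro q hq
    have h1 : (hfin q hq).1.toFinset ⊆ F q ∪ {(q : ℤ) • v, (-(q : ℤ)) • v} := by
      intro x hx
      have hx' : qfVal a x = ((m : ℤ) * q) ^ 2 := by simpa using hx
      by_cases h0 : qfProj a v x = 0
      · have := eq_or_eq_neg_of_qfProj_eq_zero hm hv hx' h0
        simp only [Finset.mem_union, Finset.mem_insert, Finset.mem_singleton]
        exact Or.inr this
      · exact Finset.mem_union_left _ ((hF q hq x).2 ⟨hx', h0⟩)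
    have h2 := (Finset.card_le_card h1).trans ((Finset.card_union_le _ _).trans
      (Nat.add_le_add_left Finset.card_le_two _))
    have h3 := (hfin q hq).2
    rw [Set.ncard_eq_toFinset_card _ (hfin q hq).1] at h3
    have h4 : t ≤ t ^ ((2 * r + 3) * (r + 1)) := Nat.le_self_pow (by positivity) t
    omega
  let U := P.sigma F
  have hUlow : t ^ ((2 * r + 4) * (r + 1)) * t ^ (r + 2) ≤ 4 * U.card := by
    rw [Finset.card_sigma, Finset.mul_sum]
    calc t ^ ((2 * r + 4) * (r + 1)) * t ^ (r + 2)
        = t ^ (2 * r + 3) * t ^ ((2 * r + 3) * (r + 1)) := by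
          rw [← pow_add, ← pow_add]; congr 1; ring
      _ ≤ P.card * t ^ ((2 * r + 3) * (r + 1)) := Nat.mul_le_mul_right _ hPcard
      _ = ∑ q ∈ P, t ^ ((2 * r + 3) * (r + 1)) := by rw [Finset.sum_const, smul_eq_mul]
      _ ≤ _ := Finset.sum_le_sum hFcard
  have hdiv : ∀ n : ℕ, n ≠ 0 → n ≤ 4 * m ^ 4 * X ^ 2 →
      n.divisors.card ≤ (t ^ (r + 2) - 1) / K := by
    intro n hn hnX
    rw [Nat.le_div_iff_mul_le hK0]
    apply Nat.le_sub_one_of_lt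
    apply lt_of_pow_lt_pow_left₀ 8 (Nat.zero_le _)
    calc (n.divisors.card * K) ^ 8 = K ^ 8 * n.divisors.card ^ 8 := by ring
      _ ≤ K ^ 8 * (C * (4 * m ^ 4 * X ^ 2)) :=
        Nat.mul_le_mul_left _ ((hC n hn).trans (Nat.mul_le_mul_left _ hnX))
      _ = K ^ 8 * (C * (4 * m ^ 4)) * X ^ 2 := by ring
      _ < t * X ^ 2 := Nat.mul_lt_mul_of_pos_right (by omega) (by positivity)
      _ = t ^ (4 * r + 9) := by rw [hX]; ring
      _ ≤ (t ^ (r + 2)) ^ 8 := by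
        rw [← pow_mul]
        exact Nat.pow_le_pow_right ht1 (by omega)
  have hUup := card_le_of_hyperplane ha hm hv hdiv hl0 hlv U (by
    intro u hu
    obtain ⟨h1, h2⟩ := Finset.mem_sigma.1 hu
    obtain ⟨h3, h4⟩ := (hF _ h1 _).1 h2
    have h5 : u.1 ≤ X := (Nat.mem_primesLE.1 (Finset.mem_filter.1 h1).1).1
    refine ⟨h5, h3, hl _ ?_, h4⟩
    rw [h3]
    apply pow_le_pow_left₀ (by positivity)
    exact_mod_cast Nat.mul_le_mul_left m h5)
  have hN : (4 * m ^ 3 * X + 1) ^ (r + 3 - 2) ≤ (5 * m ^ 3) ^ (r + 1) * t ^ ((2 * r + 4) * (r + 1)) := by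
    rw [pow_mul t, ← hX, ← mul_pow]
    apply Nat.pow_le_pow_left
    have : 1 ≤ m ^ 3 * X := Nat.mul_pos (pow_pos hm 3) hX1
    nlinarith
  have hle : t ^ ((2 * r + 4) * (r + 1)) * t ^ (r + 2) ≤
      t ^ ((2 * r + 4) * (r + 1)) * ((t ^ (r + 2) - 1) / K * K) := by
    calc _ ≤ 4 * U.card := hUlow
      _ ≤ 4 * ((t ^ (r + 2) - 1) / K *
          ((5 * m ^ 3) ^ (r + 1) * t ^ ((2 * r + 4) * (r + 1)))) :=
        Nat.mul_le_mul_left _ (hUup.trans (Nat.mul_le_mul_left _ hN))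
      _ = t ^ ((2 * r + 4) * (r + 1)) * ((t ^ (r + 2) - 1) / K * (4 * (5 * m ^ 3) ^ (r + 1))) := by
        ring
      _ = _ := by rw [← hK]
  have h1 := Nat.le_of_mul_le_mul_left hle (by positivity)
  have h2 := Nat.div_mul_le_self (t ^ (r + 2) - 1) K
  have h3 : 0 < t ^ (r + 2) := by positivity
  omega

theorem det_sq_mul_qfVal {k : ℕ} (a : Fin k → Fin k → ℤ) (v : Fin k → Fin k → ℤ)
    (x : Fin k → ℤ) :
    (Matrix.of v).det ^ 2 * (2 * qfVal a x) =
      dotProduct ((Matrix.of v).transpose.adjugate.mulVec x)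
        ((Matrix.of fun i j => qfPolar a (v i) (v j)).mulVec
          ((Matrix.of v).transpose.adjugate.mulVec x)) := by
  set V := Matrix.of v
  set y := V.transpose.adjugate.mulVec x with hy
  have h1 : V.det • x = V.transpose.mulVec y := by
    rw [hy, Matrix.mulVec_mulVec, Matrix.mul_adjugate, Matrix.det_transpose, Matrix.smul_mulVec,
      Matrix.one_mulVec]
  have h2 := qfPolar_self a (V.det • x)
  rw [qfVal_smul, h1, qfPolar_apply] at h2
  rw [gram_eq_mul, Matrix.mul_assoc, ← Matrix.mulVec_mulVec, ← Matrix.mulVec_mulVec,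
    Matrix.dotProduct_mulVec, ← Matrix.mulVec_transpose, h2]
  ring

theorem exists_mul_eq_of_forall_exists_mulVec {k : ℕ} (A B : Matrix (Fin k) (Fin k) ℤ)
    (h : ∀ y, ∃ z, A.mulVec z = B.mulVec y) : ∃ M : Matrix (Fin k) (Fin k) ℤ, A * M = B := by
  choose z hz using fun j : Fin k => h (Pi.single j 1)
  refine ⟨(Matrix.of z).transpose, ?_⟩
  ext i j
  have := congrFun (hz j) i
  simp only [Matrix.mulVec_single_one] at this
  simpa [Matrix.mul_apply, Matrix.mulVec, dotProduct] using this

theorem exists_mulVec_eq_of_box {k : ℕ} (A A' V V' : Matrix (Fin k) (Fin k) ℤ) {δ K : ℤ}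
    (hδ : δ ≠ 0) (hδK : |δ| ≤ K) (hAV : A * V = δ • 1) (hAV' : A' * V' = δ • 1)
    (hbox : ∀ x : Fin k → ℤ, (∀ i, |x i| ≤ K) → (∃ y, A'.mulVec y = x) → ∃ y, A.mulVec y = x)
    (y : Fin k → ℤ) : ∃ z, A.mulVec z = A'.mulVec y := by
  set x := A'.mulVec y with hx
  let w : Fin k → ℤ := fun i => x i / δ
  let x' : Fin k → ℤ := fun i => x i % δ
  have hdecomp : x' + δ • w = x := by
    ext i
    simp only [Pi.add_apply, Pi.smul_apply, smul_eq_mul, x', w]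
    exact Int.emod_add_mul_ediv (x i) δ
  have hx'1 : ∀ i, |x' i| ≤ K := by
    intro i
    have h1 := Int.emod_nonneg (x i) hδ
    have h2 := Int.emod_lt_abs (x i) hδ
    rw [abs_of_nonneg h1]
    exact h2.le.trans hδK
  have hx'2 : ∃ y, A'.mulVec y = x' := by
    refine ⟨y - V'.mulVec w, ?_⟩
    rw [Matrix.mulVec_sub, Matrix.mulVec_mulVec, hAV', Matrix.smul_mulVec, Matrix.one_mulVec,
      ← hx, ← hdecomp, add_sub_cancel_right]
  obtain ⟨z, hz⟩ := hbox x' hx'1 hx'2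
  refine ⟨z + V.mulVec w, ?_⟩
  rw [Matrix.mulVec_add, Matrix.mulVec_mulVec, hAV, Matrix.smul_mulVec, Matrix.one_mulVec, hz,
    hdecomp]

theorem qfEquiv_of_gram_eq {k : ℕ} {a a' : Fin k → Fin k → ℤ} {v v' : Fin k → Fin k → ℤ} {K : ℤ}
    (hdet : (Matrix.of v).det ≠ 0) (hK : |(Matrix.of v).det| ≤ K)
    (hdet' : (Matrix.of v').det = (Matrix.of v).det)
    (hG : ∀ i j, qfPolar a (v i) (v j) = qfPolar a' (v' i) (v' j))
    (hT : ∀ x : Fin k → ℤ, (∀ i, |x i| ≤ K) →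
      ((∃ y, (Matrix.of v).transpose.adjugate.mulVec y = x) ↔
        ∃ y, (Matrix.of v').transpose.adjugate.mulVec y = x)) :
    qfEquiv a a' := by
  have hAV : (Matrix.of v).transpose.adjugate * (Matrix.of v).transpose =
      (Matrix.of v).det • 1 := by
    rw [Matrix.adjugate_mul, Matrix.det_transpose]
  have hAV' : (Matrix.of v').transpose.adjugate * (Matrix.of v').transpose =
      (Matrix.of v).det • 1 := by
    rw [Matrix.adjugate_mul, Matrix.det_transpose, hdet']
  obtain ⟨M, hM⟩ := exists_mul_eq_of_forall_exists_mulVec _ _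
    (exists_mulVec_eq_of_box _ _ _ _ hdet hK hAV hAV' fun x hx h => (hT x hx).2 h)
  obtain ⟨M', hM'⟩ := exists_mul_eq_of_forall_exists_mulVec _ _
    (exists_mulVec_eq_of_box _ _ _ _ hdet hK hAV' hAV fun x hx h => (hT x hx).1 h)
  have hMM : M * M' = 1 := by
    have h1 : (Matrix.of v).det • (M * M') = (Matrix.of v).det • 1 := by
      have h2 : (Matrix.of v).transpose * (Matrix.of v).transpose.adjugate =
          (Matrix.of v).det • 1 := by
        rw [Matrix.mul_adjugate, Matrix.det_transpose]
      calc (Matrix.of v).det • (M * M')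
          = ((Matrix.of v).det • (1 : Matrix (Fin k) (Fin k) ℤ)) * (M * M') := by
            rw [Matrix.smul_mul, Matrix.one_mul]
        _ = (Matrix.of v).det • 1 := by
            rw [← h2, Matrix.mul_assoc, ← Matrix.mul_assoc _ M, hM, hM']
    exact smul_right_injective _ hdet h1
  refine ⟨M, IsUnit.of_mul_eq_one M'.det (by rw [← Matrix.det_mul, hMM, Matrix.det_one]),
    fun x => ?_⟩
  have h1 := det_sq_mul_qfVal a' v' x
  have h2 := det_sq_mul_qfVal a v (M.mulVec x)
  have hGm : (Matrix.of fun i j => qfPolar a (v i) (v j)) =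
      Matrix.of fun i j => qfPolar a' (v' i) (v' j) := by
    ext i j
    exact hG i j
  rw [Matrix.mulVec_mulVec, hM, hGm, ← h1, hdet'] at h2
  have h3 := mul_left_cancel₀ (pow_ne_zero 2 hdet) h2
  linarith

theorem exists_finset_qfEquiv_of_short_vectors (k : ℕ) (c : ℤ) :
    ∃ S : Finset (Fin k → Fin k → ℤ), ∀ a : Fin k → Fin k → ℤ, qfPosDef a →
      (∃ v : Fin k → Fin k → ℤ, (∀ i, qfVal a (v i) ≤ c ^ 2) ∧ (Matrix.of v).det ≠ 0) →
      ∃ a' ∈ S, qfEquiv a a' := by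
  classical
  let K : ℤ := (k.factorial : ℤ) * (2 * c ^ 2) ^ k
  let D := ℤ × (Fin k → Fin k → ℤ) × Set (Fin k → ℤ)
  let R : (Fin k → Fin k → ℤ) → D → Prop := fun a s =>
    ∃ v : Fin k → Fin k → ℤ, (Matrix.of v).det ≠ 0 ∧ |(Matrix.of v).det| ≤ K ∧
      s = ((Matrix.of v).det, fun i j => qfPolar a (v i) (v j),
        {x | (∀ i, |x i| ≤ K) ∧ ∃ y, (Matrix.of v).transpose.adjugate.mulVec y = x})
  have hR : ∀ a a' s, R a s → R a' s → qfEquiv a a' := by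
    rintro a a' s ⟨v, hv0, hvK, rfl⟩ ⟨v', -, -, hs⟩
    obtain ⟨h1, h2⟩ := Prod.mk.inj hs
    obtain ⟨h3, h4⟩ := Prod.mk.inj h2
    refine qfEquiv_of_gram_eq hv0 hvK h1.symm (fun i j => congrFun (congrFun h3 i) j)
      fun x hx => ?_
    have h5 := Set.ext_iff.1 h4 x
    simpa [hx] using h5
  let F : Set D := Set.Icc (-K) K ×ˢ (Set.Icc (fun _ _ => -(2 * c ^ 2)) (fun _ _ => 2 * c ^ 2) ×ˢ
    {b | b ⊆ Set.Icc (fun _ => -K) (fun _ => K)})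
  have hF : F.Finite := (Set.finite_Icc _ _).prod ((Set.finite_Icc _ _).prod
    (Set.finite_Icc _ _).finite_subsets)
  have hmem : ∀ a, qfPosDef a →
      (∃ v : Fin k → Fin k → ℤ, (∀ i, qfVal a (v i) ≤ c ^ 2) ∧ (Matrix.of v).det ≠ 0) →
      ∃ s ∈ F, R a s := by
    rintro a ha ⟨v, hv, hv0⟩
    have hG : ∀ i j, |qfPolar a (v i) (v j)| ≤ 2 * c ^ 2 := fun i j =>
      abs_qfPolar_le ha (hv i) (hv j)
    have hdet : |(Matrix.of v).det| ≤ K := by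
      have h1 := abs_det_sq_mul_qfDisc_le ha v hv
      have h2 : 1 ≤ |qfDisc a| := Int.one_le_abs (qfDisc_ne_zero ha)
      have h3 : 1 ≤ |(Matrix.of v).det| := Int.one_le_abs hv0
      rw [← sq_abs] at h1
      nlinarith [mul_le_mul_of_nonneg_left h2 (sq_nonneg |(Matrix.of v).det|)]
    refine ⟨((Matrix.of v).det, fun i j => qfPolar a (v i) (v j),
      {x | (∀ i, |x i| ≤ K) ∧ ∃ y, (Matrix.of v).transpose.adjugate.mulVec y = x}),
      ⟨abs_le.1 hdet, ⟨fun i j => (abs_le.1 (hG i j)).1, fun i j =>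
      (abs_le.1 (hG i j)).2⟩, fun x hx => ⟨fun i => (abs_le.1 (hx.1 i)).1,
      fun i => (abs_le.1 (hx.1 i)).2⟩⟩, v, hv0, hdet, rfl⟩
  let g : D → (Fin k → Fin k → ℤ) := fun s => if h : ∃ a, R a s then h.choose else 0
  refine ⟨hF.toFinset.image g, fun a ha hv => ?_⟩
  obtain ⟨s, hs, has⟩ := hmem a ha hv
  refine ⟨g s, Finset.mem_image_of_mem _ (hF.mem_toFinset.2 hs), hR a _ s has ?_⟩
  have h : ∃ a, R a s := ⟨a, has⟩
  simp only [g, dif_pos h]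
  exact h.choose_spec

theorem exists_forall_lt_two_pow (A T e : ℕ) :
    ∃ Ω : ℕ, ∀ w : ℕ, 2 ^ w ≤ A * (T + w) ^ e → w ≤ Ω := by
  have h := tendsto_pow_const_div_const_pow_of_one_lt e (show (1 : ℝ) < 2 by norm_num)
  have hpos : (0 : ℝ) < 1 / (A * (T + 1) ^ e + 1) := by positivity
  obtain ⟨Ω, hΩ⟩ := Filter.eventually_atTop.1
    ((h.eventually_lt_const hpos).and (Filter.eventually_ge_atTop 1))
  refine ⟨Ω, fun w hw => ?_⟩
  by_contra hlt
  obtain ⟨h1, h2⟩ := hΩ w (by omega)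
  rw [div_lt_div_iff₀ (by positivity) (by positivity), one_mul] at h1
  have h3 : A * (T + w) ^ e ≤ A * ((T + 1) ^ e * w ^ e) := by
    rw [← mul_pow]
    apply Nat.mul_le_mul_left
    apply Nat.pow_le_pow_left
    nlinarith
  have h4 : (w : ℝ) ^ e * (A * (T + 1) ^ e + 1) < A * ((T + 1) ^ e * w ^ e) := by
    refine h1.trans_le ?_
    exact_mod_cast hw.trans h3
  have h5 : (0 : ℝ) ≤ (w : ℝ) ^ e := by positivity
  nlinarith

theorem two_pow_card_primeFactors_le {n : ℕ} (hn : n ≠ 0) : 2 ^ n.primeFactors.card ≤ n :=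
  calc 2 ^ n.primeFactors.card ≤ ∏ p ∈ n.primeFactors, p :=
        Finset.pow_card_le_prod _ _ _ fun _ hp => (Nat.prime_of_mem_primeFactors hp).two_le
    _ ≤ n := Nat.le_of_dvd (Nat.pos_of_ne_zero hn) (Nat.prod_primeFactors_dvd n)

/-- Strongly s-regular forms of fixed rank and `m_s` have linearly independent vectors of bounded
length. -/
theorem exists_short_vectors_bound (r m : ℕ) (hm : 0 < m) :
    ∃ c : ℤ, ∀ a : Fin (r + 3) → Fin (r + 3) → ℤ, qfPosDef a → StronglySSRegular a →
      qfRep a ((m : ℤ) ^ 2) ≠ 0 → qfMs a = m →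
      ∃ v : Fin (r + 3) → Fin (r + 3) → ℤ,
        (∀ i, qfVal a (v i) ≤ c ^ 2) ∧ (Matrix.of v).det ≠ 0 := by
  obtain ⟨T, hT⟩ := exists_hyperplane_bound r m hm
  obtain ⟨Ω, hΩ⟩ := exists_forall_lt_two_pow (2 * ((r + 3).factorial * (2 * m ^ 2) ^ (r + 3))) T
    ((2 * r + 4) * 2 * (r + 3))
  refine ⟨((m * (T + Ω) ^ (2 * r + 4) : ℕ) : ℤ), fun a ha hreg hrep hms => ?_⟩
  set w := (2 * qfDisc a).natAbs.primeFactors.card with hw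
  have hd := qfDisc_ne_zero ha
  rcases exists_det_ne_zero_or_exists_ker
    {x | qfVal a x ≤ ((m * (T + w) ^ (2 * r + 4) : ℕ) : ℤ) ^ 2} with ⟨v, hv, hv0⟩ | ⟨l, hl0, hl⟩
  · have h1 := abs_det_sq_mul_qfDisc_le ha v hv
    have h2 : |qfDisc a| ≤
        ((r + 3).factorial : ℤ) * (2 * ((m * (T + w) ^ (2 * r + 4) : ℕ) : ℤ) ^ 2) ^ (r + 3) := by
      refine le_trans ?_ h1
      have h3 : 1 ≤ (Matrix.of v).det ^ 2 := by
        have := sq_pos_of_ne_zero hv0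
        omega
      exact le_mul_of_one_le_left (abs_nonneg _) h3
    have h4 : w ≤ Ω := by
      apply hΩ
      refine (two_pow_card_primeFactors_le (by simpa using hd)).trans ?_
      zify
      rw [abs_mul, abs_two]
      refine (mul_le_mul_of_nonneg_left h2 (by norm_num)).trans (le_of_eq ?_)
      push_cast
      rw [mul_pow (m : ℤ), ← pow_mul _ (2 * r + 4) 2, ← mul_assoc (2 : ℤ) ((m : ℤ) ^ 2), mul_pow,
        ← pow_mul _ _ (r + 3)]
      ring
    refine ⟨v, fun i => (hv i).trans ?_, hv0⟩
    apply pow_le_pow_left₀ (by positivity)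
    exact_mod_cast Nat.mul_le_mul_left m (Nat.pow_le_pow_left (Nat.add_le_add_left h4 T) _)
  · exact absurd (hT (T + w) (Nat.le_add_right _ _) a ha hreg hrep hms (Nat.le_add_left _ _) l hl)
      hl0

/-- For each `k ≥ 3` and positive integer `m`, there are only finitely many isometry
classes of strongly s-regular positive definite forms of rank `k` with `m_s = m`. -/
theorem stmt_12 (k : ℕ) (hk : 3 ≤ k) (m : ℕ) (hm : 0 < m) :
    ∃ S : Finset (Fin k → Fin k → ℤ),
      ∀ a : Fin k → Fin k → ℤ, qfPosDef a → StronglySSRegular a →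
        (∃ n : ℕ, 0 < n ∧ qfRep a ((n : ℤ) ^ 2) ≠ 0) →
        qfMs a = m →
        ∃ a' ∈ S, qfEquiv a a' := by
  obtain ⟨r, rfl⟩ := Nat.exists_eq_add_of_le' hk
  obtain ⟨c, hc⟩ := exists_short_vectors_bound r m hm
  obtain ⟨S, hS⟩ := exists_finset_qfEquiv_of_short_vectors (r + 3) c
  refine ⟨S, fun a ha hreg hrep hms => hS a ha (hc a ha hreg ?_ hms)⟩
  have h : qfMs a ∈ {n : ℕ | 0 < n ∧ qfRep a ((n : ℤ) ^ 2) ≠ 0} := Nat.sInf_mem hrep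
  rw [hms] at h
  exact h.2
end

section
/- (Hurwitz) For the form f(x,y,z) = x² + y² + z² and every positive integer n, r(n², f) = 6 · ∏_{p odd prime dividing n} [ (p^{ν_p(n)+1} − 1)/(p − 1) − (−1 | p) · (p^{ν_p(n)} − 1)/(p − 1) ], where ν_p(n) = ord_p(n) and (−1 | p) is the Legendre symbol. -/
open Finset

/-- The value of the diagonal ternary form `a x² + b y² + c z²`. -/
def tVal (a b c : ℤ) (v : ℤ × ℤ × ℤ) : ℤ :=
  a * v.1 ^ 2 + b * v.2.1 ^ 2 + c * v.2.2 ^ 2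

/-- The number of representations of `n` by the diagonal ternary form `a x² + b y² + c z²`. -/
noncomputable def tRep (a b c n : ℤ) : ℕ :=
  Set.ncard {v : ℤ × ℤ × ℤ | tVal a b c v = n}

/-- The local factor `h_p(μ)` for a diagonal ternary form `a x² + b y² + c z²`. -/
def tHp (a b c : ℤ) (p : ℕ) (μ : ℕ) : ℤ :=
  ((p : ℤ) ^ (μ + 1) - 1) / ((p : ℤ) - 1) -
    jacobiSym (-(a * b * c)) p * (((p : ℤ) ^ μ - 1) / ((p : ℤ) - 1))

/-- The sum of the nontrivial character modulo four over the divisors of `n`. -/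
def chiSum (n : ℕ) : ℤ := ∑ d ∈ n.divisors, ZMod.χ₄ d

theorem sum_divisors_mul_filter_dvd {p m : ℕ} (hp : p.Prime) (hm : m ≠ 0) :
    ∑ d ∈ (p * m).divisors with p ∣ d, ZMod.χ₄ d = ZMod.χ₄ p * chiSum m := by
  rw [chiSum, mul_sum]
  symm
  refine sum_nbij (p * ·) ?_ ?_ ?_ ?_
  · intro d hd
    simp only [mem_filter, Nat.mem_divisors] at hd ⊢
    exact ⟨⟨mul_dvd_mul_left p hd.1, mul_ne_zero hp.ne_zero hm⟩, dvd_mul_right p d⟩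
  · intro a _ b _ hab
    exact Nat.eq_of_mul_eq_mul_left hp.pos hab
  · intro d hd
    simp only [coe_filter, Nat.mem_divisors, Set.mem_ofPred_eq] at hd
    obtain ⟨⟨h1, -⟩, e, rfl⟩ := hd
    exact ⟨e, by simpa using ⟨Nat.dvd_of_mul_dvd_mul_left hp.pos h1, hm⟩, rfl⟩
  · intro d _
    rw [Nat.cast_mul, map_mul]

theorem chiSum_prime_mul {p m : ℕ} (hp : p.Prime) (hm : m ≠ 0) :
    chiSum (p * m) =
      chiSum m + ZMod.χ₄ p * chiSum m - ∑ d ∈ m.divisors with p ∣ d, ZMod.χ₄ d := by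
  have h : ∑ d ∈ (p * m).divisors with ¬ p ∣ d, ZMod.χ₄ d =
      ∑ d ∈ m.divisors with ¬ p ∣ d, ZMod.χ₄ d := by
    congr 1
    ext d
    simp only [mem_filter, Nat.mem_divisors]
    constructor
    · rintro ⟨⟨h1, -⟩, h2⟩
      exact ⟨⟨((hp.coprime_iff_not_dvd.2 h2).symm.dvd_of_dvd_mul_left h1), hm⟩, h2⟩
    · rintro ⟨⟨h1, -⟩, h2⟩
      exact ⟨⟨h1.mul_left p, mul_ne_zero hp.ne_zero hm⟩, h2⟩
  have h1 := sum_filter_add_sum_filter_not (p * m).divisors (p ∣ ·) (fun d => ZMod.χ₄ d)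
  have h2 := sum_filter_add_sum_filter_not m.divisors (p ∣ ·) (fun d => ZMod.χ₄ d)
  rw [sum_divisors_mul_filter_dvd hp hm, h] at h1
  rw [chiSum, ← h1, chiSum, ← h2]
  ring

theorem GaussianInt.norm_eq (z : GaussianInt) : z.norm = z.re ^ 2 + z.im ^ 2 := by
  rw [Zsqrtd.norm_def]; ring

theorem GaussianInt.finite_norm_eq (n : ℤ) : {z : GaussianInt | z.norm = n}.Finite := by
  refine Set.Finite.subset (((Icc (-n) n ×ˢ Icc (-n) n).image
    fun x => (⟨x.1, x.2⟩ : GaussianInt)).finite_toSet) ?_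
  rintro ⟨a, b⟩ (h : Zsqrtd.norm _ = n)
  rw [GaussianInt.norm_eq] at h
  simp only at h
  have h1 := Int.le_self_sq a
  have h2 := Int.le_self_sq b
  have h3 := Int.le_self_sq (-a)
  have h4 := Int.le_self_sq (-b)
  rw [neg_sq] at h3 h4
  simp only [coe_image, Set.mem_image, mem_coe, mem_product, mem_Icc, Prod.exists]
  exact ⟨a, b, by refine ⟨⟨?_, ?_⟩, ?_, ?_⟩ <;> nlinarith, rfl⟩

/-- The Gaussian integers of norm `n`. -/
noncomputable def gaussSphere (n : ℤ) : Finset GaussianInt :=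
  (GaussianInt.finite_norm_eq n).toFinset

@[simp] theorem mem_gaussSphere {n : ℤ} {z : GaussianInt} : z ∈ gaussSphere n ↔ z.norm = n := by
  simp [gaussSphere]

open Classical in
theorem card_gaussSphere_filter_dvd {w : GaussianInt} (hw : w ≠ 0) (m : ℤ) :
    #{z ∈ gaussSphere (w.norm * m) | w ∣ z} = #(gaussSphere m) := by
  have hn : w.norm ≠ 0 := (GaussianInt.norm_pos.2 hw).ne'
  symm
  refine card_nbij (w * ·) ?_ ?_ ?_
  · intro z hz
    rw [mem_coe, mem_gaussSphere] at hz
    rw [mem_coe, mem_filter, mem_gaussSphere, Zsqrtd.norm_mul, hz]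
    exact ⟨rfl, dvd_mul_right w z⟩
  · intro a _ b _ hab
    exact mul_left_cancel₀ hw hab
  · intro z hz
    simp only [coe_filter, mem_gaussSphere, Set.mem_ofPred_eq] at hz
    obtain ⟨h1, e, rfl⟩ := hz
    rw [Zsqrtd.norm_mul] at h1
    exact ⟨e, by simpa using mul_left_cancel₀ hn h1, rfl⟩

theorem GaussianInt.star_dvd {w z : GaussianInt} (h : w ∣ z) : star w ∣ star z := by
  obtain ⟨e, rfl⟩ := h
  exact ⟨star e, by rw [star_mul']⟩

theorem card_gaussSphere_prime_mul_of_one {p : ℕ} (hp : p.Prime) (h4 : p % 4 = 1) (m : ℤ) :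
    (#(gaussSphere (p * m)) : ℤ) =
      2 * #(gaussSphere m) - #{z ∈ gaussSphere (p * m) | (p : ℤ) ∣ z.re ∧ (p : ℤ) ∣ z.im} := by
  classical
  have : Fact p.Prime := ⟨hp⟩
  obtain ⟨a, b, hab⟩ := Nat.Prime.sq_add_sq (p := p) (by omega)
  set w : GaussianInt := ⟨a, b⟩ with hw
  have hwn : w.norm = p := by rw [GaussianInt.norm_eq, hw, ← hab]; push_cast; rfl
  have hw0 : w ≠ 0 := by
    rw [← GaussianInt.norm_pos, hwn]; exact_mod_cast hp.pos
  have hsn : (star w).norm = p := by rw [Zsqrtd.norm_conj, hwn]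
  have hs0 : star w ≠ 0 := by
    rw [← GaussianInt.norm_pos, hsn]; exact_mod_cast hp.pos
  have hirr : ∀ v : GaussianInt, v.norm = p → Prime v := by
    intro v hv
    rw [← irreducible_iff_prime]
    constructor
    · rw [← Zsqrtd.norm_eq_one_iff, hv]; simpa using hp.ne_one
    · intro x y hxy
      have h := congrArg (fun z : GaussianInt => z.norm.natAbs) hxy
      simp only [Zsqrtd.norm_mul, Int.natAbs_mul, hv, Int.natAbs_natCast] at h
      rw [← Zsqrtd.norm_eq_one_iff, ← Zsqrtd.norm_eq_one_iff]
      rcases (Nat.prime_mul_iff.1 (h ▸ hp)) with h | h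
      · exact Or.inr h.2
      · exact Or.inl h.2
  have hmul : (p : GaussianInt) = w * star w := by
    rw [← Zsqrtd.norm_eq_mul_conj, hwn]; simp
  have hndvd : ¬ w ∣ star w := by
    intro h
    have h2 : w ∣ ((2 * a : ℤ) : GaussianInt) := by
      have : ((2 * a : ℤ) : GaussianInt) = w + star w := by
        rw [hw, Zsqrtd.ext_iff]; simp; ring
      rw [this]; exact dvd_add dvd_rfl h
    obtain ⟨e, he⟩ := h2
    have h3 := congrArg Zsqrtd.norm he
    rw [Zsqrtd.norm_intCast, Zsqrtd.norm_mul, hwn] at h3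
    have h4' : (p : ℤ) ∣ (2 * a) * (2 * a) := ⟨_, h3⟩
    have h5 : p ∣ (2 * a) * (2 * a) := by exact_mod_cast h4'
    have h6 : p ∣ a := by
      rcases (hp.dvd_mul.1 h5) with h | h <;> rcases hp.dvd_mul.1 h with h | h
      all_goals first | exact h | (have := Nat.le_of_dvd two_pos h; have := hp.two_le; grind)
    have h7 : p ∣ b := by
      have : p ∣ b ^ 2 := by
        rw [← Nat.dvd_add_right (h6.pow two_ne_zero |>.trans (dvd_refl _) : p ∣ a ^ 2), hab]
      exact hp.dvd_of_dvd_pow this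
    have h8 : p ^ 2 ∣ p := by
      have := dvd_add (pow_dvd_pow_of_dvd h6 2) (pow_dvd_pow_of_dvd h7 2)
      rwa [hab] at this
    have := Nat.le_of_dvd hp.pos h8
    nlinarith [hp.two_le]
  have hunion : gaussSphere (p * m) = {z ∈ gaussSphere (p * m) | w ∣ z} ∪
      {z ∈ gaussSphere (p * m) | star w ∣ z} := by
    rw [← filter_or, eq_comm, filter_eq_self]
    intro z hz
    rw [mem_gaussSphere] at hz
    have h1 : w ∣ z * star z := by
      rw [← Zsqrtd.norm_eq_mul_conj, hz]
      push_cast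
      rw [hmul, mul_assoc]
      exact dvd_mul_right _ _
    rcases (hirr w hwn).dvd_or_dvd h1 with h | h
    · exact Or.inl h
    · right
      simpa using GaussianInt.star_dvd h
  have hinter : {z ∈ gaussSphere (p * m) | w ∣ z} ∩ {z ∈ gaussSphere (p * m) | star w ∣ z} =
      {z ∈ gaussSphere (p * m) | (p : ℤ) ∣ z.re ∧ (p : ℤ) ∣ z.im} := by
    rw [← filter_and]
    refine filter_congr fun z _ => ?_
    rw [← Zsqrtd.intCast_dvd, Int.cast_natCast, hmul]
    constructor
    · rintro ⟨⟨e, rfl⟩, h2⟩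
      refine mul_dvd_mul_left w (((hirr _ hsn).dvd_or_dvd h2).resolve_left ?_)
      intro h
      exact hndvd (by simpa using GaussianInt.star_dvd h)
    · intro h
      exact ⟨(dvd_mul_right _ _).trans h, (dvd_mul_left _ _).trans h⟩
  have hc := card_union_add_card_inter {z ∈ gaussSphere (p * m) | w ∣ z}
    {z ∈ gaussSphere (p * m) | star w ∣ z}
  have e1 := card_gaussSphere_filter_dvd hw0 m
  have e2 := card_gaussSphere_filter_dvd hs0 m
  rw [hwn] at e1
  rw [hsn] at e2
  rw [← hunion, hinter, e1, e2] at hc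
  have := congrArg (Nat.cast : ℕ → ℤ) hc
  push_cast at this
  linarith

theorem card_gaussSphere_prime_mul_of_three {p : ℕ} (hp : p.Prime) (h4 : p % 4 = 3) (m : ℤ) :
    #{z ∈ gaussSphere (p * m) | (p : ℤ) ∣ z.re ∧ (p : ℤ) ∣ z.im} = #(gaussSphere (p * m)) := by
  have : Fact p.Prime := ⟨hp⟩
  have hprime := GaussianInt.prime_of_nat_prime_of_mod_four_eq_three p h4
  congr 1
  rw [filter_eq_self]
  intro z hz
  rw [mem_gaussSphere] at hz
  rw [← Zsqrtd.intCast_dvd, Int.cast_natCast]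
  have h1 : (p : GaussianInt) ∣ z * star z := by
    rw [← Zsqrtd.norm_eq_mul_conj, hz]
    push_cast
    exact dvd_mul_right _ _
  rcases hprime.dvd_or_dvd h1 with h | h
  · exact h
  · simpa using GaussianInt.star_dvd h

theorem χ₄_mul_self_of_odd {n : ℕ} (hn : Odd n) : ZMod.χ₄ n * ZMod.χ₄ n = 1 := by
  rcases Nat.odd_mod_four_iff.1 (Nat.odd_iff.1 hn) with h | h
  · rw [ZMod.χ₄_nat_one_mod_four h, one_mul]
  · rw [ZMod.χ₄_nat_three_mod_four h]; norm_num

theorem card_gaussSphere_filter_prime_dvd {p m : ℕ} (hp : p.Prime) (hodd : Odd p) (hm : m ≠ 0)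
    (hi : ∀ k, p * k = m → (#(gaussSphere k) : ℤ) = 4 * chiSum k) :
    (#{z ∈ gaussSphere (p * m) | (p : ℤ) ∣ z.re ∧ (p : ℤ) ∣ z.im} : ℤ) =
      4 * ZMod.χ₄ p * ∑ d ∈ m.divisors with p ∣ d, ZMod.χ₄ d := by
  classical
  have hp0 : (p : ℤ) ≠ 0 := by exact_mod_cast hp.ne_zero
  by_cases hpm : p ∣ m
  · obtain ⟨k, rfl⟩ := hpm
    have hk : k ≠ 0 := by rintro rfl; simp at hm
    have h := card_gaussSphere_filter_dvd (w := ((p : ℤ) : GaussianInt))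
      (by rwa [Ne, Int.cast_eq_zero]) k
    simp only [Zsqrtd.norm_intCast, Zsqrtd.intCast_dvd, mul_assoc] at h
    rw [Nat.cast_mul, h, hi k rfl, sum_divisors_mul_filter_dvd hp hk]
    linear_combination -4 * chiSum k * χ₄_mul_self_of_odd hodd
  · rw [filter_eq_empty_iff.2, filter_eq_empty_iff.2]
    · simp
    · intro d hd h
      exact hpm (h.trans (Nat.dvd_of_mem_divisors hd))
    · rintro z hz ⟨⟨a, ha⟩, b, hb⟩
      rw [mem_gaussSphere, GaussianInt.norm_eq, ha, hb] at hz
      apply hpm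
      have : (m : ℤ) = p * (a ^ 2 + b ^ 2) := by
        apply mul_left_cancel₀ hp0
        rw [← hz]; ring
      exact_mod_cast Dvd.intro _ this.symm

/-- Jacobi's two squares theorem for odd numbers. -/
theorem card_gaussSphere {n : ℕ} (hn : Odd n) : (#(gaussSphere n) : ℤ) = 4 * chiSum n := by
  induction n using Nat.strong_induction_on with
  | _ n ih =>
  by_cases h1 : n = 1
  · subst h1
    have : gaussSphere (1 : ℕ) = {⟨1, 0⟩, ⟨-1, 0⟩, ⟨0, 1⟩, ⟨0, -1⟩} := by
      ext ⟨a, b⟩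
      simp only [mem_gaussSphere, GaussianInt.norm_eq, mem_insert, mem_singleton, Zsqrtd.mk.injEq,
        Nat.cast_one]
      constructor
      · intro h
        have : a ≤ 1 := by nlinarith
        have : -1 ≤ a := by nlinarith
        have : b ≤ 1 := by nlinarith
        have : -1 ≤ b := by nlinarith
        interval_cases a <;> interval_cases b <;> simp_all
      · rintro (h | h | h | h) <;> simp [h]
    rw [this]
    simp [chiSum]
  · obtain ⟨m, hm⟩ := n.minFac_dvd
    have hp := Nat.minFac_prime h1
    generalize n.minFac = p at hm hp
    subst hm
    obtain ⟨hpo, hmo⟩ := Nat.odd_mul.1 hn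
    have hm0 : m ≠ 0 := hmo.pos.ne'
    have him := ih m (by nlinarith [hp.two_le, hmo.pos]) hmo
    have hd := card_gaussSphere_filter_prime_dvd hp hpo hm0 (fun k hk => ih k (by
      subst hk
      have : 0 < k := (Nat.odd_mul.1 hmo).2.pos
      nlinarith [hp.two_le, Nat.mul_le_mul hp.two_le hp.two_le]) (by
      subst hk; exact (Nat.odd_mul.1 hmo).2))
    rw [chiSum_prime_mul hp hm0, Nat.cast_mul]
    rcases Nat.odd_mod_four_iff.1 (Nat.odd_iff.1 hpo) with h | h
    · rw [card_gaussSphere_prime_mul_of_one hp h, hd, him, ZMod.χ₄_nat_one_mod_four h]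
      ring
    · rw [← card_gaussSphere_prime_mul_of_three hp h, hd, ZMod.χ₄_nat_three_mod_four h]
      ring

/-- The quadruples `(a, b, c, d)` of odd natural numbers with `a * b + c * d = 2 * m`. -/
def oddQuads (m : ℕ) : Finset (ℕ × ℕ × ℕ × ℕ) :=
  (range (2 * m + 1) ×ˢ range (2 * m + 1) ×ˢ range (2 * m + 1) ×ˢ range (2 * m + 1)).filter
    fun v => v.1 * v.2.1 + v.2.2.1 * v.2.2.2 = 2 * m ∧
      Odd v.1 ∧ Odd v.2.1 ∧ Odd v.2.2.1 ∧ Odd v.2.2.2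

theorem mem_oddQuads {m a b c d : ℕ} : (a, b, c, d) ∈ oddQuads m ↔
    a * b + c * d = 2 * m ∧ Odd a ∧ Odd b ∧ Odd c ∧ Odd d := by
  simp only [oddQuads, mem_filter, mem_product, mem_range, and_iff_right_iff_imp]
  rintro ⟨h, ha, hb, hc, hd⟩
  have := Nat.le_mul_of_pos_right a hb.pos
  have := Nat.le_mul_of_pos_left b ha.pos
  have := Nat.le_mul_of_pos_right c hd.pos
  have := Nat.le_mul_of_pos_left d hc.pos
  omega

theorem sum_oddQuads_eq_sum_chiSum (m : ℕ) :
    ∑ v ∈ oddQuads m, ZMod.χ₄ v.1 * ZMod.χ₄ v.2.2.1 =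
      ∑ j ∈ range (2 * m) with Odd j, chiSum j * chiSum (2 * m - j) := by
  have hmaps : ∀ v ∈ oddQuads m, v.1 * v.2.1 ∈ {j ∈ range (2 * m) | Odd j} := by
    rintro ⟨a, b, c, d⟩ hv
    obtain ⟨h, ha, hb, hc, hd⟩ := mem_oddQuads.1 hv
    simp only [mem_filter, mem_range]
    exact ⟨by have := Nat.mul_pos hc.pos hd.pos; omega, ha.mul hb⟩
  rw [← sum_fiberwise_of_maps_to hmaps]
  refine sum_congr rfl fun j hj => ?_
  rw [mem_filter, mem_range] at hj
  rw [chiSum, chiSum, sum_mul_sum, ← sum_product']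
  refine sum_bij' (fun v _ => (v.1, v.2.2.1))
    (fun x _ => (x.1, j / x.1, x.2, (2 * m - j) / x.2)) ?_ ?_ ?_ ?_ ?_
  · rintro ⟨a, b, c, d⟩ hv
    simp only [mem_filter, mem_oddQuads] at hv
    obtain ⟨⟨h, ha, hb, hc, hd⟩, rfl⟩ := hv
    simp only [mem_product, Nat.mem_divisors]
    exact ⟨⟨dvd_mul_right _ _, hj.2.pos.ne'⟩, ⟨d, by omega⟩, by omega⟩
  · rintro ⟨a, c⟩ hx
    simp only [mem_product, Nat.mem_divisors] at hx
    obtain ⟨⟨⟨b, hb⟩, -⟩, ⟨d, hd⟩, -⟩ := hx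
    have h1 : Odd (a * b) := hb ▸ hj.2
    have h2 : Odd (c * d) := by
      rw [← hd, Nat.odd_sub' hj.1.le]; simp [hj.2]
    rw [Nat.odd_mul] at h1 h2
    simp only [mem_filter, mem_oddQuads]
    rw [hd, hb, Nat.mul_div_cancel_left _ h1.1.pos, Nat.mul_div_cancel_left _ h2.1.pos]
    exact ⟨⟨by rw [← hb, ← hd]; omega, h1.1, h1.2, h2.1, h2.2⟩, rfl⟩
  · rintro ⟨a, b, c, d⟩ hv
    simp only [mem_filter, mem_oddQuads] at hv
    obtain ⟨⟨h, ha, hb, hc, hd⟩, rfl⟩ := hv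
    have : 2 * m - a * b = c * d := by omega
    simp only [this, Nat.mul_div_cancel_left _ ha.pos, Nat.mul_div_cancel_left _ hc.pos]
  · intros; rfl
  · intros; rfl

theorem χ₄_mul_χ₄_eq_ite {a c : ℕ} (ha : Odd a) (hc : Odd c) :
    ZMod.χ₄ a * ZMod.χ₄ c = if a % 4 = c % 4 then 1 else -1 := by
  rcases Nat.odd_mod_four_iff.1 (Nat.odd_iff.1 ha) with h | h <;>
  rcases Nat.odd_mod_four_iff.1 (Nat.odd_iff.1 hc) with h' | h' <;>
  simp only [ZMod.χ₄_nat_one_mod_four, ZMod.χ₄_nat_three_mod_four, h, h'] <;> norm_num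

/-- Dirichlet's involution on the odd quadruples `(a, b, c, d)` with `c < a`. -/
def dirichletSwap (v : ℕ × ℕ × ℕ × ℕ) : ℕ × ℕ × ℕ × ℕ :=
  let t := v.1 - v.2.2.1
  let s := v.2.1 + v.2.2.2
  let y := v.1 / t
  (v.2.1 + y * s, v.1 % t, v.2.1 + y * s - s, t - v.1 % t)

theorem dirichletSwap_apply {b d r q y : ℕ} (hq : 0 < q) :
    dirichletSwap ((y + 1) * (r + q) + r, b, y * (r + q) + r, d) =
      ((y + 1) * (b + d) + b, r, y * (b + d) + b, q) := by
  have h1 : (y + 1) * (r + q) + r - (y * (r + q) + r) = r + q := by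
    rw [add_one_mul]; omega
  have h2 : ((y + 1) * (r + q) + r) / (r + q) = y + 1 := by
    rw [mul_comm, Nat.mul_add_div (by omega), Nat.div_eq_of_lt (by omega), add_zero]
  have h3 : ((y + 1) * (r + q) + r) % (r + q) = r := by
    rw [Nat.mul_add_mod', Nat.mod_eq_of_lt]; omega
  simp only [dirichletSwap, h1, h2, h3, Prod.mk.injEq, add_tsub_cancel_left, true_and, and_true]
  constructor
  · ring
  · rw [add_one_mul]; omega

theorem exists_swap_parameters {a c : ℕ} (ha : Odd a) (hc : Odd c) (h : c < a) :
    ∃ r q y, Odd r ∧ Odd q ∧ a = (y + 1) * (r + q) + r ∧ c = y * (r + q) + r := by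
  obtain ⟨t, ht⟩ : ∃ t, t = a - c := ⟨_, rfl⟩
  have hr := Nat.div_add_mod c t
  have hlt := Nat.mod_lt c (show 0 < t by omega)
  have hte : Even t := by rw [ht, Nat.even_sub h.le]; simp [← Nat.not_odd_iff_even, ha, hc]
  obtain ⟨q, hq⟩ := Nat.exists_eq_add_of_lt hlt
  have hro : Odd (c % t) := (Nat.odd_iff.2 (by rw [Nat.mod_mod_of_dvd _ hte.two_dvd, Nat.odd_iff.1 hc]))
  refine ⟨c % t, q + 1, c / t, hro, ?_, ?_, ?_⟩
  · rw [hq, add_assoc, Nat.even_add, ← Nat.not_odd_iff_even, ← Nat.not_odd_iff_even] at hte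
    tauto
  · rw [← add_assoc, ← hq, add_one_mul]; linarith [Nat.sub_add_cancel h.le]
  · rw [← add_assoc, ← hq]; linarith

theorem mul_add_mul_swap (b d r q y : ℕ) :
    ((y + 1) * (r + q) + r) * b + (y * (r + q) + r) * d =
      ((y + 1) * (b + d) + b) * r + (y * (b + d) + b) * q := by
  ring

theorem sum_oddQuads_lt {m : ℕ} (hm : Odd m) :
    ∑ v ∈ oddQuads m with v.2.2.1 < v.1, ZMod.χ₄ v.1 * ZMod.χ₄ v.2.2.1 = 0 := by
  have key : ∀ v ∈ {v ∈ oddQuads m | v.2.2.1 < v.1}, dirichletSwap v ∈ oddQuads m ∧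
      (dirichletSwap v).2.2.1 < (dirichletSwap v).1 ∧ dirichletSwap (dirichletSwap v) = v ∧
      ZMod.χ₄ v.1 * ZMod.χ₄ v.2.2.1 +
        ZMod.χ₄ (dirichletSwap v).1 * ZMod.χ₄ (dirichletSwap v).2.2.1 = 0 := by
    rintro ⟨a, b, c, d⟩ hv
    rw [mem_filter, mem_oddQuads] at hv
    obtain ⟨⟨h, ha, hb, hc, hd⟩, hlt⟩ := hv
    obtain ⟨r, q, y, hr, hq, rfl, rfl⟩ := exists_swap_parameters ha hc hlt
    have he : Even (b + d) := hb.add_odd hd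
    have ha' : Odd ((y + 1) * (b + d) + b) := (he.mul_left _).add_odd hb
    have hc' : Odd (y * (b + d) + b) := (he.mul_left _).add_odd hb
    rw [dirichletSwap_apply hq.pos, dirichletSwap_apply hd.pos, mem_oddQuads]
    refine ⟨⟨by rw [← mul_add_mul_swap, h], ha', hr, hc', hq⟩, ?_, rfl, ?_⟩
    · have := hb.pos
      simp only [add_one_mul]
      omega
    · simp only
      rw [χ₄_mul_χ₄_eq_ite ha hc, χ₄_mul_χ₄_eq_ite ha' hc']
      obtain ⟨T, hT⟩ := hr.add_odd hq
      obtain ⟨S, hS⟩ := he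
      have h4 : T * b + r * S + 2 * (y * T * S) = m := by
        have : ((y + 1) * (r + q) + r) * b + (y * (r + q) + r) * d =
            y * (r + q) * (b + d) + (r + q) * b + r * (b + d) := by ring
        rw [h, hT, hS] at this
        nlinarith
      have h6 : Odd T ↔ ¬ Odd S := by
        rw [← h4] at hm
        simp only [Nat.odd_add, Nat.odd_mul, hb, even_two_mul, iff_true, and_true] at hm
        rw [hm, ← Nat.not_odd_iff_even, Nat.odd_mul, and_iff_right hr]
      have h7 : ∀ k u x : ℕ, ((x + 1) * (k + k) + u) % 4 = (x * (k + k) + u) % 4 ↔ ¬ Odd k := by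
        intro k u x
        rw [add_one_mul, Nat.odd_iff]
        omega
      rw [hT, hS, if_congr (h7 T r y) rfl rfl, if_congr (h7 S b y) rfl rfl]
      by_cases hS' : Odd S
      · rw [if_pos (by tauto), if_neg (by tauto)]; norm_num
      · rw [if_neg (by tauto), if_pos (by tauto)]; norm_num
  refine sum_involution (fun v _ => dirichletSwap v) ?_ ?_ ?_ ?_
  · intro v hv
    exact (key v hv).2.2.2
  · intro v hv hne heq
    have := (key v hv).2.2.2
    rw [heq] at this
    omega
  · intro v hv
    exact mem_filter.2 ⟨(key v hv).1, (key v hv).2.1⟩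
  · intro v hv
    exact (key v hv).2.2.1

theorem sum_oddQuads_gt {m : ℕ} (hm : Odd m) :
    ∑ v ∈ oddQuads m with v.1 < v.2.2.1, ZMod.χ₄ v.1 * ZMod.χ₄ v.2.2.1 = 0 := by
  rw [← sum_oddQuads_lt hm]
  refine sum_nbij' (fun v => (v.2.2.1, v.2.2.2, v.1, v.2.1))
    (fun v => (v.2.2.1, v.2.2.2, v.1, v.2.1)) ?_ ?_ ?_ ?_ ?_
  · rintro ⟨a, b, c, d⟩ hv
    rw [mem_filter, mem_oddQuads] at hv ⊢
    exact ⟨⟨by rw [← hv.1.1, add_comm], hv.1.2.2.2.1, hv.1.2.2.2.2, hv.1.2.1, hv.1.2.2.1⟩, hv.2⟩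
  · rintro ⟨a, b, c, d⟩ hv
    rw [mem_filter, mem_oddQuads] at hv ⊢
    exact ⟨⟨by rw [← hv.1.1, add_comm], hv.1.2.2.2.1, hv.1.2.2.2.2, hv.1.2.1, hv.1.2.2.1⟩, hv.2⟩
  · intros; rfl
  · intros; rfl
  · intros; exact mul_comm _ _

theorem card_oddQuads_eq {m : ℕ} (hm : Odd m) :
    #{v ∈ oddQuads m | v.1 = v.2.2.1} = ∑ a ∈ m.divisors, m / a := by
  have : ∑ a ∈ m.divisors, m / a = #(m.divisors.sigma fun a => range (m / a)) := by
    simp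
  rw [this]
  refine card_nbij' (fun v => ⟨v.1, v.2.1 / 2⟩)
    (fun x => (x.1, 2 * x.2 + 1, x.1, 2 * (m / x.1) - (2 * x.2 + 1))) ?_ ?_ ?_ ?_
  · rintro ⟨a, b, c, d⟩ hv
    rw [mem_coe, mem_filter, mem_oddQuads] at hv
    obtain ⟨⟨h, ha, ⟨b, rfl⟩, -, ⟨d, rfl⟩⟩, hac⟩ := hv
    obtain rfl : a = c := hac
    have h1 : m = a * (b + d + 1) := by linarith
    simp only [mem_coe, mem_sigma, Nat.mem_divisors, mem_range]
    refine ⟨⟨⟨_, h1⟩, hm.pos.ne'⟩, ?_⟩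
    rw [h1, Nat.mul_div_cancel_left _ ha.pos]
    omega
  · rintro ⟨a, i⟩ hx
    simp only [mem_coe, mem_sigma, Nat.mem_divisors, mem_range] at hx
    obtain ⟨⟨⟨k, rfl⟩, -⟩, hi⟩ := hx
    have ha := (Nat.odd_mul.1 hm).1
    rw [Nat.mul_div_cancel_left _ ha.pos] at hi
    rw [mem_coe, mem_filter, mem_oddQuads]
    simp only [Nat.mul_div_cancel_left _ ha.pos]
    refine ⟨⟨?_, ha, ⟨i, rfl⟩, ha, ⟨k - i - 1, by omega⟩⟩, trivial⟩
    rw [← mul_add, Nat.add_sub_cancel' (by omega)]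
    ring
  · rintro ⟨a, b, c, d⟩ hv
    rw [mem_coe, mem_filter, mem_oddQuads] at hv
    obtain ⟨⟨h, ha, ⟨b, rfl⟩, -, ⟨d, rfl⟩⟩, hac⟩ := hv
    obtain rfl : a = c := hac
    have h1 : m = a * (b + d + 1) := by linarith
    simp only [Prod.mk.injEq, true_and, h1, Nat.mul_div_cancel_left _ ha.pos]
    omega
  · rintro ⟨a, i⟩ hx
    simp only [Sigma.mk.injEq, heq_eq_eq, true_and]
    omega

/-- A convolution identity going back to Jacobi and Dirichlet. -/
theorem sum_chiSum_mul_chiSum {m : ℕ} (hm : Odd m) :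
    ∑ j ∈ range (2 * m) with Odd j, chiSum j * chiSum (2 * m - j) =
      ((∑ a ∈ m.divisors, a : ℕ) : ℤ) := by
  have h1 := sum_filter_add_sum_filter_not (oddQuads m) (fun v => v.1 = v.2.2.1)
    fun v => ZMod.χ₄ v.1 * ZMod.χ₄ v.2.2.1
  have h2 := sum_filter_add_sum_filter_not {v ∈ oddQuads m | ¬ v.1 = v.2.2.1}
    (fun v => v.1 < v.2.2.1) fun v => ZMod.χ₄ v.1 * ZMod.χ₄ v.2.2.1
  rw [filter_filter, filter_filter,
    filter_congr (q := fun v => v.1 < v.2.2.1) (fun v _ => by grind), sum_oddQuads_gt hm,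
    filter_congr (q := fun v => v.2.2.1 < v.1) (fun v _ => by grind), sum_oddQuads_lt hm] at h2
  rw [← sum_oddQuads_eq_sum_chiSum, ← Nat.sum_div_divisors m (fun a => a), ← card_oddQuads_eq hm,
    ← h1, ← h2, add_zero, add_zero, card_eq_sum_ones]
  push_cast
  refine sum_congr rfl ?_
  rintro ⟨a, b, c, d⟩ hv
  rw [mem_filter, mem_oddQuads] at hv
  rw [← hv.2]
  exact χ₄_mul_self_of_odd hv.1.2.1

/-- A positive rank one binary Hermitian form over `ℤ[i]` is a positive multiple of a primitive
one, the multiplier being the content of the form. -/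
theorem exists_primitive_hermitian {p q : ℤ} {γ : GaussianInt} (hp : 0 < p)
    (h : γ.norm = p * q) : ∃ (k : ℕ) (a b : GaussianInt), IsCoprime a b ∧ 0 < a.norm ∧
      p = k * a.norm ∧ q = k * b.norm ∧ γ = k * (a * star b) ∧
      ∀ e : ℤ, e ∣ p → e ∣ q → e ∣ γ.re → e ∣ γ.im → e ∣ k := by
  have hp' : (p : GaussianInt) ≠ 0 := by exact_mod_cast hp.ne'
  obtain ⟨a, ha⟩ := EuclideanDomain.gcd_dvd_left (p : GaussianInt) (star γ)
  obtain ⟨b, hb⟩ := EuclideanDomain.gcd_dvd_right (p : GaussianInt) (star γ)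
  have hg := EuclideanDomain.gcd_eq_gcd_ab (p : GaussianInt) (star γ)
  generalize EuclideanDomain.gcdA (p : GaussianInt) (star γ) = x at hg
  generalize EuclideanDomain.gcdB (p : GaussianInt) (star γ) = y at hg
  generalize EuclideanDomain.gcd (p : GaussianInt) (star γ) = g at ha hb hg
  have hg0 : g ≠ 0 := by rintro rfl; simp [hp.ne'] at ha
  have ha0 : a ≠ 0 := by rintro rfl; simp [hp.ne'] at ha
  have hn := GaussianInt.norm_pos.2 ha0
  have hbez : a * x + b * y = 1 := by
    apply mul_left_cancel₀ hg0
    calc g * (a * x + b * y) = (g * a) * x + (g * b) * y := by ring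
      _ = g * 1 := by rw [← ha, ← hb, ← hg, mul_one]
  have h1 : γ * star a = p * star b := by
    have : star γ * a = p * b := by rw [hb, ha]; ring
    have := congrArg star this
    simpa [star_mul'] using this
  have h2 : (a.norm : GaussianInt) * γ = p * (a * star b) := by
    rw [Zsqrtd.norm_eq_mul_conj]
    linear_combination a * h1
  have h3 : q * a.norm = p * b.norm := by
    have := congrArg Zsqrtd.norm h1
    rw [Zsqrtd.norm_mul, Zsqrtd.norm_mul, h, Zsqrtd.norm_intCast, Zsqrtd.norm_conj,
      Zsqrtd.norm_conj, mul_assoc, mul_assoc] at this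
    exact mul_left_cancel₀ hp.ne' this
  obtain ⟨k, hk⟩ : ∃ k : ℤ, k = p * x.norm + q * y.norm + 2 * (γ * (x * star y)).re := ⟨_, rfl⟩
  have hkp : p = k * a.norm := by
    have e1 : (a.norm * γ.re) = p * (a * star b).re := by
      simpa using congrArg Zsqrtd.re h2
    have e2 : (a.norm * γ.im) = p * (a * star b).im := by
      simpa using congrArg Zsqrtd.im h2
    have e3 : (a * x + b * y).norm = 1 := by rw [hbez, Zsqrtd.norm_one]
    have e4 : (a * x + b * y).norm = a.norm * x.norm + b.norm * y.norm +
        2 * ((a * star b) * (x * star y)).re := by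
      simp [Zsqrtd.norm_def]; ring
    have e5 : a.norm * (γ * (x * star y)).re = p * ((a * star b) * (x * star y)).re := by
      rw [Zsqrtd.re_mul γ (x * star y), Zsqrtd.re_mul (a * star b) (x * star y)]
      linear_combination (x * star y).re * e1 - (x * star y).im * e2
    rw [e3] at e4
    rw [hk]
    linear_combination p * e4 - 2 * e5 - y.norm * h3
  have hk0 : 0 < k := by
    by_contra hneg
    nlinarith
  lift k to ℕ using hk0.le
  refine ⟨k, a, b, ⟨x, y, by rw [← hbez]; ring⟩, hn, hkp, ?_, ?_, ?_⟩
  · apply mul_right_cancel₀ hn.ne'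
    rw [h3, hkp]; ring
  · have hn' : (a.norm : GaussianInt) ≠ 0 := by exact_mod_cast hn.ne'
    apply mul_left_cancel₀ hn'
    rw [h2]
    nth_rewrite 1 [hkp]
    push_cast
    ring
  · intro e h1 h2 h3 h4
    rw [hk, Zsqrtd.re_mul]
    exact dvd_add (dvd_add (h1.mul_right _) (h2.mul_right _))
      ((dvd_add (h3.mul_right _) ((h4.mul_left _).mul_right _)).mul_left _)

theorem bijOn_mul_primitive_hermitian {k : ℕ} {a b : GaussianInt} (hab : IsCoprime a b)
    (ha : 0 < a.norm) (hb : 0 < b.norm) (hk : 0 < k) :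
    Set.BijOn (fun g => (g * a, g * b)) (gaussSphere k)
      {v | v.1.norm = k * a.norm ∧ v.2.norm = k * b.norm ∧
        v.1 * star v.2 = k * (a * star b)} := by
  refine ⟨?_, ?_, ?_⟩
  · intro g hg
    rw [mem_coe, mem_gaussSphere] at hg
    simp only [Set.mem_ofPred_eq, Zsqrtd.norm_mul, hg, star_mul', true_and]
    have := Zsqrtd.norm_eq_mul_conj g
    rw [hg, Int.cast_natCast] at this
    rw [this]; ring
  · intro g _ g' _ h
    exact mul_right_cancel₀ (GaussianInt.norm_pos.1 ha) (Prod.mk.inj h).1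
  · rintro ⟨u, v⟩ ⟨h1, h2, h3⟩
    simp only at h1 h2 h3
    have hk' : (k : GaussianInt) ≠ 0 := by exact_mod_cast hk.ne'
    have hb0 : star b ≠ 0 := by
      rw [← GaussianInt.norm_pos, Zsqrtd.norm_conj]; exact hb
    have h4 : u * b = a * v := by
      have e := Zsqrtd.norm_eq_mul_conj v
      rw [h2] at e
      push_cast at e
      rw [Zsqrtd.norm_eq_mul_conj] at e
      apply mul_left_cancel₀ (mul_ne_zero hk' hb0)
      linear_combination u * e + v * h3
    obtain ⟨g, rfl⟩ : a ∣ u := hab.dvd_of_dvd_mul_right ⟨v, h4⟩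
    have h5 : v = b * g := by
      apply mul_left_cancel₀ (GaussianInt.norm_pos.1 ha)
      rw [← h4]; ring
    refine ⟨g, ?_, by simp only [h5, mul_comm]⟩
    rw [mem_coe, mem_gaussSphere]
    rw [Zsqrtd.norm_mul, mul_comm] at h1
    exact mul_right_cancel₀ ha.ne' h1

theorem finite_sum_three_sq_eq (n : ℤ) :
    {v : ℤ × ℤ × ℤ | v.1 ^ 2 + v.2.1 ^ 2 + v.2.2 ^ 2 = n}.Finite := by
  refine Set.Finite.subset ((Icc (-n) n ×ˢ Icc (-n) n ×ˢ Icc (-n) n).finite_toSet) ?_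
  rintro ⟨x, y, z⟩ (h : x ^ 2 + y ^ 2 + z ^ 2 = n)
  have h1 := Int.le_self_sq x
  have h2 := Int.le_self_sq y
  have h3 := Int.le_self_sq z
  have h4 := Int.le_self_sq (-x)
  have h5 := Int.le_self_sq (-y)
  have h6 := Int.le_self_sq (-z)
  rw [neg_sq] at h4 h5 h6
  simp only [mem_coe, mem_product, mem_Icc]
  refine ⟨⟨?_, ?_⟩, ⟨?_, ?_⟩, ?_, ?_⟩ <;> nlinarith

/-- The representations of `n` as an ordered sum of three squares. -/
noncomputable def threeSquares (n : ℤ) : Finset (ℤ × ℤ × ℤ) :=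
  (finite_sum_three_sq_eq n).toFinset

@[simp] theorem mem_threeSquares {n x y z : ℤ} :
    (x, y, z) ∈ threeSquares n ↔ x ^ 2 + y ^ 2 + z ^ 2 = n := by
  simp [threeSquares]

/-- The representations of `m ^ 2` as an ordered sum of three squares, the last one even. -/
noncomputable def evenTriples (m : ℕ) : Finset (ℤ × ℤ × ℤ) :=
  (threeSquares ((m : ℤ) ^ 2)).filter fun v => Even v.2.2

theorem mem_evenTriples {m : ℕ} {x y z : ℤ} :
    (x, y, z) ∈ evenTriples m ↔ x ^ 2 + y ^ 2 + z ^ 2 = (m : ℤ) ^ 2 ∧ Even z := by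
  simp [evenTriples]

/-- The pairs of Gaussian integers of odd norms adding up to `2 * m`. -/
noncomputable def normPairs (m : ℕ) : Finset (GaussianInt × GaussianInt) :=
  {j ∈ range (2 * m) | Odd j}.biUnion fun j => gaussSphere j ×ˢ gaussSphere (2 * m - j : ℕ)

theorem mem_normPairs {m : ℕ} {a b : GaussianInt} :
    (a, b) ∈ normPairs m ↔ a.norm + b.norm = 2 * m ∧ Odd a.norm := by
  simp only [normPairs, mem_biUnion, mem_filter, mem_range, mem_product, mem_gaussSphere]
  constructor
  · rintro ⟨j, ⟨hj, hodd⟩, h1, h2⟩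
    rw [h1, h2]
    exact ⟨by omega, by exact_mod_cast hodd⟩
  · rintro ⟨h, hodd⟩
    have ha := GaussianInt.norm_nonneg a
    have hb := GaussianInt.norm_nonneg b
    obtain ⟨j, hj⟩ := Int.eq_ofNat_of_zero_le ha
    rw [hj] at h hodd
    have hodd' : Odd j := by exact_mod_cast hodd
    obtain ⟨i, hi⟩ := hodd'
    exact ⟨j, ⟨by omega, i, hi⟩, hj, by omega⟩

theorem card_normPairs {m : ℕ} (hm : Odd m) :
    (#(normPairs m) : ℤ) = 16 * ((∑ a ∈ m.divisors, a : ℕ) : ℤ) := by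
  rw [← sum_chiSum_mul_chiSum hm, normPairs, card_biUnion, Nat.cast_sum, mul_sum]
  · refine sum_congr rfl fun j hj => ?_
    rw [mem_filter, mem_range] at hj
    have h : Odd (2 * m - j) := by
      obtain ⟨i, hi⟩ := hj.2
      exact ⟨m - i - 1, by omega⟩
    rw [card_product, Nat.cast_mul, card_gaussSphere hj.2, card_gaussSphere h]
    ring
  · intro i _ j _ hij
    refine disjoint_left.2 ?_
    rintro ⟨a, b⟩ h1 h2
    rw [mem_product, mem_gaussSphere] at h1 h2
    exact hij (by exact_mod_cast h1.1.symm.trans h2.1)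

/-- A version of the Hopf map. -/
def hopfMap (m : ℕ) (v : GaussianInt × GaussianInt) : ℤ × ℤ × ℤ :=
  ((v.1 * star v.2).re, (v.1 * star v.2).im, v.1.norm - m)

theorem hopfMap_mem_evenTriples {m : ℕ} (hm : Odd m) {v : GaussianInt × GaussianInt}
    (hv : v ∈ normPairs m) : hopfMap m v ∈ evenTriples m := by
  obtain ⟨a, b⟩ := v
  obtain ⟨h, hodd⟩ := mem_normPairs.1 hv
  rw [hopfMap, mem_evenTriples]
  constructor
  · rw [← GaussianInt.norm_eq, Zsqrtd.norm_mul, Zsqrtd.norm_conj]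
    have : b.norm = 2 * m - a.norm := by linarith
    rw [this]; ring
  · exact hodd.sub_odd (by exact_mod_cast hm)

theorem card_hopfMap_fiber {m : ℕ} (hm : Odd m) {x y z : ℤ} (hv : (x, y, z) ∈ evenTriples m) :
    (#{w ∈ normPairs m | hopfMap m w = (x, y, z)} : ℤ) =
      4 * ∑ e ∈ m.divisors.filter (fun e : ℕ => (e : ℤ) ∣ x ∧ (e : ℤ) ∣ y ∧ (e : ℤ) ∣ z),
        ZMod.χ₄ e := by
  obtain ⟨h, hz⟩ := mem_evenTriples.1 hv
  have hm' : Odd (m : ℤ) := by exact_mod_cast hm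
  have hp2 : Odd (m + z : ℤ) := hm'.add_even hz
  have hq2 : Odd (m - z : ℤ) := hm'.sub_even hz
  have hprod : (⟨x, y⟩ : GaussianInt).norm = (m + z) * (m - z) := by
    rw [GaussianInt.norm_eq]; linear_combination h
  have hm0 : (0 : ℤ) < m := by exact_mod_cast hm.pos
  have hzm : |z| ≤ |(m : ℤ)| := sq_le_sq.1 (by nlinarith)
  rw [abs_of_pos hm0, abs_le] at hzm
  have hp : (0 : ℤ) < m + z := by
    obtain ⟨i, hi⟩ := hp2
    omega
  have hq : (0 : ℤ) < m - z := by
    obtain ⟨i, hi⟩ := hq2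
    omega
  obtain ⟨k, a, b, hab, ha, hpk, hqk, hγ, hk⟩ := exists_primitive_hermitian hp hprod
  have hk0 : 0 < k := by
    rcases Nat.eq_zero_or_pos k with rfl | h0
    · simp at hpk; omega
    · exact h0
  have hkodd : Odd k := by
    rw [hpk, Int.odd_mul] at hp2
    exact_mod_cast hp2.1
  have hb : 0 < b.norm := by
    rw [hqk] at hq
    exact pos_of_mul_pos_right hq (by positivity)
  have hcard : #{w ∈ normPairs m | hopfMap m w = (x, y, z)} = #(gaussSphere k) := by
    symm
    have hbij := bijOn_mul_primitive_hermitian hab ha hb hk0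
    have hset : (({w ∈ normPairs m | hopfMap m w = (x, y, z)} : Finset _) : Set _) =
        {v : GaussianInt × GaussianInt | v.1.norm = k * a.norm ∧ v.2.norm = k * b.norm ∧
        v.1 * star v.2 = k * (a * star b)} := by
      ext ⟨u, v⟩
      rw [mem_coe, mem_filter, mem_normPairs, Set.mem_ofPred_eq, hopfMap, ← hpk, ← hqk, ← hγ,
        Zsqrtd.ext_iff]
      simp only [Prod.mk.injEq]
      constructor
      · rintro ⟨⟨h1, -⟩, h3, h4, h5⟩
        exact ⟨by linarith, by linarith, h3, h4⟩
      · rintro ⟨h1, h2, h3, h4⟩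
        exact ⟨⟨by linarith, h1 ▸ hp2⟩, h3, h4, by linarith⟩
    rw [← hset] at hbij
    exact card_nbij _ hbij.mapsTo hbij.injOn hbij.surjOn
  rw [hcard, card_gaussSphere hkodd, chiSum]
  congr 2
  ext e
  simp only [mem_filter, Nat.mem_divisors]
  have hx : x = k * (a * star b).re := by
    simpa using congrArg Zsqrtd.re hγ
  have hy : y = k * (a * star b).im := by
    simpa using congrArg Zsqrtd.im hγ
  constructor
  · rintro ⟨he, -⟩
    have he' : (e : ℤ) ∣ k := by exact_mod_cast he
    have hodd : Odd (e : ℤ) := by exact_mod_cast hkodd.of_dvd_nat he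
    have hcop : IsCoprime (e : ℤ) 2 := Int.isCoprime_iff_gcd_eq_one.2 (by
      have := hkodd.of_dvd_nat he
      simpa [Int.gcd] using this)
    have h1 : (e : ℤ) ∣ m + z := hpk ▸ he'.mul_right _
    have h2 : (e : ℤ) ∣ m - z := hqk ▸ he'.mul_right _
    refine ⟨⟨?_, hm.pos.ne'⟩, hx ▸ he'.mul_right _, hy ▸ he'.mul_right _, ?_⟩
    · have : (e : ℤ) ∣ 2 * m := by
        have := dvd_add h1 h2
        ring_nf at this ⊢
        exact this
      exact_mod_cast hcop.dvd_of_dvd_mul_left this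
    · have : (e : ℤ) ∣ 2 * z := by
        have := dvd_sub h1 h2
        ring_nf at this ⊢
        exact this
      exact hcop.dvd_of_dvd_mul_left this
  · rintro ⟨⟨he, -⟩, h1, h2, h3⟩
    have he' : (e : ℤ) ∣ m := by exact_mod_cast he
    refine ⟨?_, hk0.ne'⟩
    exact_mod_cast hk e (dvd_add he' h3) (dvd_sub he' h3) h1 h2

theorem card_evenTriples_filter_dvd {m e : ℕ} (he : Odd e) (hm : e ∣ m) :
    #{v ∈ evenTriples m | (e : ℤ) ∣ v.1 ∧ (e : ℤ) ∣ v.2.1 ∧ (e : ℤ) ∣ v.2.2} =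
      #(evenTriples (m / e)) := by
  obtain ⟨n, rfl⟩ := hm
  have he0 : (e : ℤ) ≠ 0 := by exact_mod_cast he.pos.ne'
  rw [Nat.mul_div_cancel_left n he.pos]
  symm
  refine card_nbij (fun v => (e * v.1, e * v.2.1, e * v.2.2)) ?_ ?_ ?_
  · rintro ⟨x, y, z⟩ h
    rw [mem_coe, mem_evenTriples] at h
    rw [mem_coe, mem_filter, mem_evenTriples]
    refine ⟨⟨?_, h.2.mul_left _⟩, dvd_mul_right _ _, dvd_mul_right _ _, dvd_mul_right _ _⟩
    push_cast
    linear_combination (e : ℤ) ^ 2 * h.1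
  · rintro ⟨x, y, z⟩ - ⟨x', y', z'⟩ - h
    simpa [he.pos.ne'] using h
  · rintro ⟨x, y, z⟩ h
    rw [mem_coe, mem_filter, mem_evenTriples] at h
    obtain ⟨⟨h1, h2⟩, ⟨x, rfl⟩, ⟨y, rfl⟩, ⟨z, rfl⟩⟩ := h
    refine ⟨(x, y, z), ?_, rfl⟩
    rw [mem_coe, mem_evenTriples]
    refine ⟨?_, ?_⟩
    · apply mul_left_cancel₀ (pow_ne_zero 2 he0)
      push_cast at h1
      linear_combination h1
    · rw [Int.even_mul] at h2
      have : ¬ Even (e : ℤ) := by simpa using he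
      tauto

theorem sum_χ₄_mul_card_evenTriples {m : ℕ} (hm : Odd m) :
    ∑ e ∈ m.divisors, ZMod.χ₄ e * (#(evenTriples (m / e)) : ℤ) =
      4 * ((∑ a ∈ m.divisors, a : ℕ) : ℤ) := by
  have h1 := card_eq_sum_card_fiberwise (s := normPairs m) (t := evenTriples m) (f := hopfMap m)
    (fun v hv => hopfMap_mem_evenTriples hm hv)
  have h2 : (16 : ℤ) * ((∑ a ∈ m.divisors, a : ℕ) : ℤ) =
      ∑ v ∈ evenTriples m, 4 * ∑ e ∈ m.divisors,
        if ((e : ℤ) ∣ v.1 ∧ (e : ℤ) ∣ v.2.1 ∧ (e : ℤ) ∣ v.2.2) then ZMod.χ₄ e else 0 := by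
    rw [← card_normPairs hm, h1, Nat.cast_sum]
    refine sum_congr rfl fun v hv => ?_
    rw [card_hopfMap_fiber hm hv, sum_filter]
  rw [← mul_sum, sum_comm] at h2
  have h3 : ∑ e ∈ m.divisors, ∑ v ∈ evenTriples m,
        (if ((e : ℤ) ∣ v.1 ∧ (e : ℤ) ∣ v.2.1 ∧ (e : ℤ) ∣ v.2.2) then ZMod.χ₄ e else 0) =
      ∑ e ∈ m.divisors, ZMod.χ₄ e * (#(evenTriples (m / e)) : ℤ) := by
    refine sum_congr rfl fun e he => ?_
    have he := Nat.dvd_of_mem_divisors he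
    rw [← sum_filter, sum_const, card_evenTriples_filter_dvd (hm.of_dvd_nat he) he, nsmul_eq_mul,
      mul_comm]
  rw [h3] at h2
  linarith

/-- The nontrivial Dirichlet character modulo four as an arithmetic function. -/
def chiFun : ArithmeticFunction ℤ := ⟨fun n => ZMod.χ₄ n, by simp⟩

theorem chiFun_apply (n : ℕ) : chiFun n = ZMod.χ₄ n := rfl

theorem isMultiplicative_chiFun : chiFun.IsMultiplicative :=
  ⟨by simp [chiFun_apply], fun _ => by rw [chiFun_apply, Nat.cast_mul, map_mul]; rfl⟩

open ArithmeticFunction ArithmeticFunction.Moebius ArithmeticFunction.sigma in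
/-- The Dirichlet quotient of the sum-of-divisors function by the nontrivial character modulo
four, on odd numbers. -/
def hurwitzFun : ArithmeticFunction ℤ := chiFun.pmul (μ * chiFun.pmul (σ 1 : ArithmeticFunction ℕ))

open ArithmeticFunction in
theorem isMultiplicative_hurwitzFun : hurwitzFun.IsMultiplicative :=
  isMultiplicative_chiFun.pmul
    (isMultiplicative_moebius.mul (isMultiplicative_chiFun.pmul isMultiplicative_sigma.natCast))

theorem card_evenTriples {m : ℕ} (hm : Odd m) : (#(evenTriples m) : ℤ) = 4 * hurwitzFun m := by
  have key : ∀ n > 0, n ∈ {n : ℕ | Odd n} →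
      ∑ i ∈ n.divisors, ZMod.χ₄ i * (#(evenTriples i) : ℤ) =
        4 * (ZMod.χ₄ n * ((∑ a ∈ n.divisors, a : ℕ) : ℤ)) := by
    intro n hn hodd
    rw [mul_left_comm, ← sum_χ₄_mul_card_evenTriples hodd, mul_sum, ← Nat.sum_div_divisors]
    refine sum_congr rfl fun d hd => ?_
    obtain ⟨e, rfl⟩ := Nat.dvd_of_mem_divisors hd
    have hdo := χ₄_mul_self_of_odd (hodd.of_dvd_nat (dvd_mul_right d e))
    have hd0 : 0 < d := Nat.pos_of_mem_divisors hd
    rw [Nat.mul_div_cancel_left e hd0, Nat.cast_mul, map_mul]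
    linear_combination (-ZMod.χ₄ e * (#(evenTriples e) : ℤ)) * hdo
  rw [ArithmeticFunction.sum_eq_iff_sum_mul_moebius_eq_on
    {n : ℕ | Odd n} (fun a b hab hb => Odd.of_dvd_nat hb hab)] at key
  have h := key m hm.pos hm
  have h2 := χ₄_mul_self_of_odd hm
  have h3 : 4 * hurwitzFun m = ZMod.χ₄ m * (ZMod.χ₄ m * (#(evenTriples m) : ℤ)) := by
    rw [← h, hurwitzFun, ArithmeticFunction.pmul_apply, ArithmeticFunction.mul_apply, chiFun_apply,
      mul_left_comm, mul_sum]
    congr 1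
    refine sum_congr rfl fun x _ => ?_
    rw [ArithmeticFunction.pmul_apply, ArithmeticFunction.natCoe_apply,
      ArithmeticFunction.sigma_one_apply, chiFun_apply, Int.cast_id]
    ring
  rw [h3, ← mul_assoc, h2, one_mul]

theorem hurwitzFun_prime_pow {p k : ℕ} (hp : p.Prime) (hodd : Odd p) :
    hurwitzFun (p ^ k) = ∑ i ∈ range (k + 1), (p : ℤ) ^ i -
      ZMod.χ₄ p * ∑ i ∈ range k, (p : ℤ) ^ i := by
  rcases k with _ | k
  · simpa using isMultiplicative_hurwitzFun.1
  have h1 : ∀ i ∈ range (k + 1 + 1), i ∉ range 2 →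
      ((ArithmeticFunction.moebius (p ^ i) : ℤ) *
        (chiFun.pmul (ArithmeticFunction.sigma 1 : ArithmeticFunction ℕ)) (p ^ (k + 1) / p ^ i)) =
          0 := by
    intro i _ hi
    rw [mem_range, not_lt] at hi
    rw [ArithmeticFunction.moebius_apply_prime_pow hp (by omega), if_neg (by omega)]
    simp
  have h2 := χ₄_mul_self_of_odd (hodd.pow (n := k))
  have h3 := χ₄_mul_self_of_odd hodd
  rw [hurwitzFun, ArithmeticFunction.pmul_apply, ArithmeticFunction.mul_apply,
    Nat.sum_divisorsAntidiagonal (fun x y => ArithmeticFunction.moebius x *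
      (chiFun.pmul (ArithmeticFunction.sigma 1 : ArithmeticFunction ℕ)) y),
    Nat.sum_divisors_prime_pow hp,
    ← sum_subset (range_mono (by omega : 2 ≤ k + 1 + 1)) h1, sum_range_succ, sum_range_one,
    pow_zero, pow_one, ArithmeticFunction.moebius_apply_one,
    ArithmeticFunction.moebius_apply_prime hp, Nat.div_one,
    show p ^ (k + 1) / p = p ^ k by rw [pow_succ, Nat.mul_div_cancel _ hp.pos]]
  simp only [ArithmeticFunction.pmul_apply, ArithmeticFunction.natCoe_apply, chiFun_apply,
    ArithmeticFunction.sigma_one_apply_prime_pow hp]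
  push_cast at h2 ⊢
  simp only [map_pow] at h2 ⊢
  generalize ∑ i ∈ range (k + 1 + 1), (p : ℤ) ^ i = S
  generalize ∑ i ∈ range (k + 1), (p : ℤ) ^ i = T
  generalize ZMod.χ₄ (p : ZMod 4) = c at *
  linear_combination (S * c * c - c * T) * h2 + S * h3

theorem hurwitzFun_eq_prod {m : ℕ} (hm : Odd m) : hurwitzFun m = ∏ p ∈ m.primeFactors,
    (((p : ℤ) ^ (m.factorization p + 1) - 1) / ((p : ℤ) - 1) -
      jacobiSym (-1) p * (((p : ℤ) ^ (m.factorization p) - 1) / ((p : ℤ) - 1))) := by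
  rw [isMultiplicative_hurwitzFun.multiplicative_factorization _ hm.pos.ne']
  refine prod_congr m.support_factorization fun p h => ?_
  have hp := Nat.prime_of_mem_primeFactors h
  have hodd : Odd p := hm.of_dvd_nat (Nat.dvd_of_mem_primeFactors h)
  have hp1 : (p : ℤ) - 1 ≠ 0 := sub_ne_zero.2 (by exact_mod_cast hp.ne_one)
  beta_reduce
  rw [hurwitzFun_prime_pow hp hodd, jacobiSym.at_neg_one hodd, ← geom_sum_mul, ← geom_sum_mul,
    Int.mul_ediv_cancel _ hp1, Int.mul_ediv_cancel _ hp1]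

theorem even_of_sum_three_sq_eq_four_mul {x y z N : ℤ} (h : x ^ 2 + y ^ 2 + z ^ 2 = 4 * N) :
    Even x ∧ Even y ∧ Even z := by
  rcases Int.even_or_odd' x with ⟨a, rfl | rfl⟩ <;> rcases Int.even_or_odd' y with ⟨b, rfl | rfl⟩ <;>
    rcases Int.even_or_odd' z with ⟨c, rfl | rfl⟩ <;> ring_nf at h <;>
    first | omega | simp

theorem card_threeSquares_four_mul (N : ℤ) :
    #(threeSquares (4 * N)) = #(threeSquares N) := by
  symm
  refine card_nbij (fun v => (2 * v.1, 2 * v.2.1, 2 * v.2.2)) ?_ ?_ ?_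
  · rintro ⟨x, y, z⟩ h
    rw [mem_coe, mem_threeSquares] at h ⊢
    linear_combination 4 * h
  · rintro ⟨x, y, z⟩ - ⟨x', y', z'⟩ - h
    simpa using h
  · rintro ⟨x, y, z⟩ h
    rw [mem_coe, mem_threeSquares] at h
    obtain ⟨hx, hy, hz⟩ := even_of_sum_three_sq_eq_four_mul h
    obtain ⟨x, rfl⟩ := hx.two_dvd
    obtain ⟨y, rfl⟩ := hy.two_dvd
    obtain ⟨z, rfl⟩ := hz.two_dvd
    refine ⟨(x, y, z), ?_, rfl⟩
    rw [mem_coe, mem_threeSquares]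
    linarith

theorem two_even_of_sum_three_sq_odd_sq {x y z m : ℤ} (hm : Odd m)
    (h : x ^ 2 + y ^ 2 + z ^ 2 = m ^ 2) :
    (if Even x then 1 else 0) + (if Even y then 1 else 0) + (if Even z then 1 else 0) = 2 := by
  obtain ⟨k, rfl⟩ := hm
  rcases Int.even_or_odd' x with ⟨a, rfl | rfl⟩ <;> rcases Int.even_or_odd' y with ⟨b, rfl | rfl⟩ <;>
    rcases Int.even_or_odd' z with ⟨c, rfl | rfl⟩ <;> ring_nf at h <;>
    first | omega | simp

theorem two_mul_card_threeSquares {m : ℕ} (hm : Odd m) :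
    2 * #(threeSquares ((m : ℤ) ^ 2)) = 3 * #(evenTriples m) := by
  have h1 : #{v ∈ threeSquares ((m : ℤ) ^ 2) | Even v.1} = #(evenTriples m) := by
    refine card_nbij' (fun v => (v.2.2, v.2.1, v.1)) (fun v => (v.2.2, v.2.1, v.1)) ?_ ?_
      (fun _ _ => rfl) (fun _ _ => rfl) <;>
    · rintro ⟨x, y, z⟩ h
      simp only [coe_filter, Set.mem_ofPred_eq, mem_coe, mem_threeSquares, mem_evenTriples] at h ⊢
      exact ⟨by linarith, h.2⟩
  have h2 : #{v ∈ threeSquares ((m : ℤ) ^ 2) | Even v.2.1} = #(evenTriples m) := by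
    refine card_nbij' (fun v => (v.1, v.2.2, v.2.1)) (fun v => (v.1, v.2.2, v.2.1)) ?_ ?_
      (fun _ _ => rfl) (fun _ _ => rfl) <;>
    · rintro ⟨x, y, z⟩ h
      simp only [coe_filter, Set.mem_ofPred_eq, mem_coe, mem_threeSquares, mem_evenTriples] at h ⊢
      exact ⟨by linarith, h.2⟩
  have h3 : ∑ v ∈ threeSquares ((m : ℤ) ^ 2), ((if Even v.1 then 1 else 0) +
      (if Even v.2.1 then 1 else 0) + (if Even v.2.2 then 1 else 0)) =
      #(threeSquares ((m : ℤ) ^ 2)) * 2 := by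
    refine sum_const_nat ?_
    rintro ⟨x, y, z⟩ h
    exact two_even_of_sum_three_sq_odd_sq (by exact_mod_cast hm) (mem_threeSquares.1 h)
  rw [sum_add_distrib, sum_add_distrib, ← card_filter, ← card_filter, ← card_filter, h1, h2,
    ← evenTriples] at h3
  omega

theorem tRep_one_one_one (n : ℤ) : tRep 1 1 1 n = #(threeSquares n) := by
  rw [tRep, ← Set.ncard_coe_finset]
  congr 1
  ext ⟨x, y, z⟩
  simp [tVal]

theorem card_threeSquares_two_pow_mul_sq (k m : ℕ) :
    #(threeSquares (((2 ^ k * m : ℕ) : ℤ) ^ 2)) = #(threeSquares ((m : ℤ) ^ 2)) := by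
  induction k with
  | zero => simp
  | succ k ih =>
    rw [← ih, ← card_threeSquares_four_mul (((2 ^ k * m : ℕ) : ℤ) ^ 2)]
    congr 2
    push_cast
    ring

/-- Hurwitz's formula for the number of representations of `n²` as a sum of three
squares. -/
theorem stmt_13 (n : ℕ) (hn : 0 < n) :
    (tRep 1 1 1 ((n : ℤ) ^ 2) : ℤ) =
      6 * ∏ p ∈ n.primeFactors.filter (fun p => p ≠ 2),
        (((p : ℤ) ^ (n.factorization p + 1) - 1) / ((p : ℤ) - 1) -
          jacobiSym (-1) p *
            (((p : ℤ) ^ (n.factorization p) - 1) / ((p : ℤ) - 1))) := by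
  obtain ⟨k, m, hm, rfl⟩ := Nat.exists_eq_two_pow_mul_odd hn.ne'
  have hfac : ∀ p, p ≠ 2 → (2 ^ k * m).factorization p = m.factorization p := by
    intro p hp
    rw [Nat.factorization_mul (by positivity) hm.pos.ne', Nat.prime_two.factorization_pow]
    simp [hp.symm]
  have hset : (2 ^ k * m).primeFactors.filter (fun p => p ≠ 2) = m.primeFactors := by
    ext p
    rw [mem_filter, ← Nat.support_factorization, ← Nat.support_factorization,
      Finsupp.mem_support_iff, Finsupp.mem_support_iff]
    constructor
    · rintro ⟨h1, h2⟩
      rwa [← hfac p h2]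
    · intro h
      have h2 : p ≠ 2 := by
        rintro rfl
        exact h (Nat.factorization_eq_zero_of_not_dvd hm.not_two_dvd_nat)
      exact ⟨by rwa [hfac p h2], h2⟩
  have h1 := two_mul_card_threeSquares hm
  have h2 := card_evenTriples hm
  rw [tRep_one_one_one, card_threeSquares_two_pow_mul_sq, hset,
    prod_congr rfl fun p hp => by
      rw [hfac p (by rintro rfl; exact hm.not_two_dvd_nat (Nat.dvd_of_mem_primeFactors hp))],
    ← hurwitzFun_eq_prod hm]
  linarith
end
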